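/- arXiv:0912.4913 — 3 statements merged into one kernel-verified Lean document; each statement's English description precedes it below -/
import Mathlib

section
/- For every real number q with 0 < q < 1, the generalized continued fraction 1/(1 + q/(1 + q²/(1 + q³/(1 + ⋯)))) — i.e. the continued fraction with b₀ = 0, all partial denominators equal to 1, first partial numerator 1 and n-th partial numerator qⁿ⁻¹ for n ≥ 2 — converges, and its value equals the infinite product ∏_{n=1}^∞ (1 − qⁿ)^{χ₅(n)}, where χ₅(n) = 1 if n ≡ 1 or 4 (mod 5), χ₅(n) = −1 if n ≡ 2 or 3 (mod 5), and χ₅(n) = 0 if n ≡ 0 (mod 5). -/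
/-- The Legendre symbol modulo 5 as an integer-valued function. -/
def chi5 (n : ℕ) : ℤ :=
  if n % 5 = 1 ∨ n % 5 = 4 then 1
  else if n % 5 = 2 ∨ n % 5 = 3 then -1
  else 0

/-- The Rogers–Ramanujan continued fraction (without the `q^{1/5}` prefactor):
the generalized continued fraction with head term `0`, all partial denominators `1`,
and `n`-th partial numerator `q^{n-1}` (so the first partial numerator is `1`). -/
noncomputable def rogersRamanujanGCF (q : ℝ) : GenContFract ℝ :=
  ⟨0, Stream'.Seq.ofStream (fun n : ℕ => ⟨q ^ n, 1⟩)⟩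

open Filter Topology Finset

/-- The `n`-th partial product `(1 - q)(1 - q²)⋯(1 - qⁿ)` of the Euler function. -/
noncomputable def eulerProd (q : ℝ) (n : ℕ) : ℝ := ∏ i ∈ range n, (1 - q ^ (i + 1))

/-- The inverse of `eulerProd`, extended by zero to negative indices. -/
noncomputable def invEulerProd (q : ℝ) (k : ℤ) : ℝ :=
  if k < 0 then 0 else (eulerProd q k.toNat)⁻¹

theorem eulerProd_succ (q : ℝ) (n : ℕ) :
    eulerProd q (n + 1) = eulerProd q n * (1 - q ^ (n + 1)) :=
  prod_range_succ _ _

theorem one_sub_pow_succ_pos {q : ℝ} (h0 : 0 < q) (h1 : q < 1) (n : ℕ) : 0 < 1 - q ^ (n + 1) :=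
  sub_pos.2 (pow_lt_one₀ h0.le h1 n.succ_ne_zero)

theorem eulerProd_pos {q : ℝ} (h0 : 0 < q) (h1 : q < 1) (n : ℕ) : 0 < eulerProd q n :=
  prod_pos fun i _ => one_sub_pow_succ_pos h0 h1 i

theorem antitone_eulerProd {q : ℝ} (h0 : 0 < q) (h1 : q < 1) : Antitone (eulerProd q) :=
  antitone_nat_of_succ_le fun n => by
    rw [eulerProd_succ]
    exact mul_le_of_le_one_right (eulerProd_pos h0 h1 n).le (by linarith [pow_pos h0 (n + 1)])

theorem eulerProd_le_one {q : ℝ} (h0 : 0 < q) (h1 : q < 1) (n : ℕ) : eulerProd q n ≤ 1 := by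
  simpa [eulerProd] using antitone_eulerProd h0 h1 n.zero_le

theorem invEulerProd_sub_one {q : ℝ} (h0 : 0 < q) (h1 : q < 1) (k : ℤ) :
    invEulerProd q (k - 1) = (1 - q ^ k) * invEulerProd q k := by
  rcases lt_trichotomy k 0 with h | rfl | h
  · simp [invEulerProd, h, show k - 1 < 0 by omega]
  · simp [invEulerProd]
  · obtain ⟨n, rfl⟩ : ∃ n : ℕ, k = n + 1 := ⟨(k - 1).toNat, by omega⟩
    have h2 : ((n : ℤ) + 1).toNat = n + 1 := by omega
    have h3 : q ^ ((n : ℤ) + 1) = q ^ (n + 1) := by exact_mod_cast zpow_natCast q (n + 1)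
    rw [invEulerProd, invEulerProd, if_neg (by omega), if_neg (by omega), h2, h3, eulerProd_succ,
      add_sub_cancel_right, Int.toNat_natCast, mul_inv]
    field_simp [(one_sub_pow_succ_pos h0 h1 n).ne']

/-- An infinite product `∏ (1 - aₙ)` with `aₙ < 1` and `∑ aₙ` summable has a positive value. -/
theorem exists_pos_tendsto_prod_one_sub {a : ℕ → ℝ} (ha : Summable a) (h1 : ∀ n, a n < 1) :
    ∃ l, 0 < l ∧ Tendsto (fun n => ∏ i ∈ range n, (1 - a i)) atTop (𝓝 l) := by
  have hs : Summable fun n => ‖-a n‖ := by simpa using ha.abs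
  have hne : ∏' n, (1 + -a n) ≠ 0 :=
    tprod_one_add_ne_zero_of_summable (fun n => by linarith [h1 n]) hs
  have ht := (multipliable_one_add_of_summable hs).tendsto_prod_tprod_nat
  simp only [← sub_eq_add_neg] at ht hne
  exact ⟨_, lt_of_le_of_ne (ge_of_tendsto' ht fun n =>
    prod_nonneg fun i _ => by linarith [h1 i]) hne.symm, ht⟩

theorem exists_pos_tendsto_eulerProd {q : ℝ} (h0 : 0 < q) (h1 : q < 1) :
    ∃ l, 0 < l ∧ Tendsto (eulerProd q) atTop (𝓝 l) :=
  exists_pos_tendsto_prod_one_sub (a := fun i => q ^ (i + 1))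
    ((summable_nat_add_iff 1).2 (summable_geometric_of_lt_one h0.le h1))
    (fun n => pow_lt_one₀ h0.le h1 n.succ_ne_zero)

/-- The finite form of the Jacobi triple product, for the sequence
`e j = (-1) ^ j * z ^ j * q ^ (j * (j - 1) / 2)` characterized by its recursion. -/
theorem hasSum_finite_jacobi {q z : ℝ} (h0 : 0 < q) (h1 : q < 1) (hz : z ≠ 0) {e : ℤ → ℝ}
    (e0 : e 0 = 1) (he : ∀ j, e (j + 1) = -(z * q ^ j) * e j) (n : ℕ) :
    HasSum (fun j : ℤ => eulerProd q (2 * n) *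
        (invEulerProd q (n - j) * invEulerProd q (n + j)) * e j)
      (∏ i ∈ range n, ((1 - z * q ^ i) * (1 - q ^ (i + 1) / z))) := by
  induction n with
  | zero =>
    convert hasSum_single (0 : ℤ) ?_ using 1
    · simp [eulerProd, invEulerProd, e0]
    · intro j hj
      rcases lt_or_gt_of_ne hj with h | h <;> simp [invEulerProd, h]
  | succ n ih =>
    have hr := ((Equiv.subRight (1 : ℤ)).hasSum_iff.2 ih).mul_left (-(z * q ^ n))
    have hl := ((Equiv.addRight (1 : ℤ)).hasSum_iff.2 ih).mul_left (-(q ^ (n + 1) / z))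
    have hm := ih.mul_left (1 + q ^ (2 * n + 1))
    have hsum := (hm.add hr).add hl
    rw [← add_mul, ← add_mul, show 1 + q ^ (2 * n + 1) + -(z * q ^ n) + -(q ^ (n + 1) / z) =
      (1 - z * q ^ n) * (1 - q ^ (n + 1) / z) by field_simp; ring] at hsum
    rw [prod_range_succ, mul_comm (∏ i ∈ range n, _)]
    refine hsum.congr_fun fun j => ?_
    have hq := h0.ne'
    have hT : q ^ j ≠ 0 := zpow_ne_zero j hq
    have z1 : q ^ ((n : ℤ) + 1 - j) = q ^ n * q / q ^ j := by
      rw [zpow_sub₀ hq, zpow_add_one₀ hq, zpow_natCast]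
    have z2 : q ^ ((n : ℤ) + 1 + j) = q ^ n * q * q ^ j := by
      rw [zpow_add₀ hq, zpow_add_one₀ hq, zpow_natCast]
    have z3 : q ^ ((n : ℤ) - j) = q ^ n / q ^ j := by rw [zpow_sub₀ hq, zpow_natCast]
    have z4 : q ^ ((n : ℤ) + j) = q ^ n * q ^ j := by rw [zpow_add₀ hq, zpow_natCast]
    have a1 := invEulerProd_sub_one h0 h1 ((n : ℤ) + 1 - j)
    have a2 := invEulerProd_sub_one h0 h1 ((n : ℤ) + 1 + j)
    have a3 := invEulerProd_sub_one h0 h1 ((n : ℤ) - j)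
    have a4 := invEulerProd_sub_one h0 h1 ((n : ℤ) + j)
    rw [show (n : ℤ) + 1 - j - 1 = n - j by ring, z1] at a1
    rw [show (n : ℤ) + 1 + j - 1 = n + j by ring, z2] at a2
    rw [z3, a1] at a3
    rw [z4, a2] at a4
    have e1 : e (j - 1) = -(e j * q / (z * q ^ j)) := by
      have := he (j - 1)
      rw [sub_add_cancel, zpow_sub_one₀ hq] at this
      rw [this]
      field_simp
    simp only [Function.comp, Equiv.subRight_apply, Equiv.coe_addRight, Nat.cast_add,
      Nat.cast_one, show (n : ℤ) - (j - 1) = n + 1 - j by ring,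
      show (n : ℤ) + (j - 1) = n + j - 1 by ring, show (n : ℤ) - (j + 1) = n - j - 1 by ring,
      show (n : ℤ) + (j + 1) = n + 1 + j by ring, a1, a2, a3, a4, e1, he,
      show 2 * (n + 1) = 2 * n + 1 + 1 by ring, eulerProd_succ]
    field_simp
    ring

theorem tendsto_invEulerProd {q l : ℝ} (hl : Tendsto (eulerProd q) atTop (𝓝 l)) (l0 : 0 < l)
    (u : ℕ → ℤ) (hu : Tendsto u atTop atTop) :
    Tendsto (fun n => invEulerProd q (u n)) atTop (𝓝 l⁻¹) := by
  have h : Tendsto (fun n => (u n).toNat) atTop atTop :=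
    tendsto_atTop.2 fun b => by
      filter_upwards [hu.eventually_ge_atTop (b : ℤ)] with n hn
      omega
  refine ((hl.comp h).inv₀ l0.ne').congr' ?_
  filter_upwards [hu.eventually_ge_atTop 0] with n hn
  simp [invEulerProd, hn]

theorem invEulerProd_nonneg {q : ℝ} (h0 : 0 < q) (h1 : q < 1) (k : ℤ) :
    0 ≤ invEulerProd q k := by
  unfold invEulerProd
  split_ifs
  · exact le_rfl
  · exact (inv_pos.2 (eulerProd_pos h0 h1 _)).le

theorem invEulerProd_le {q l : ℝ} (h0 : 0 < q) (h1 : q < 1)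
    (hl : Tendsto (eulerProd q) atTop (𝓝 l)) (l0 : 0 < l) (k : ℤ) :
    invEulerProd q k ≤ l⁻¹ := by
  unfold invEulerProd
  split_ifs
  · exact (inv_pos.2 l0).le
  · exact inv_anti₀ l0 ((antitone_eulerProd h0 h1).le_of_tendsto hl _)

theorem summable_of_jacobi_recursion {q z : ℝ} (h0 : 0 < q) (hqz : q < z) (hz : z < 1)
    {e : ℤ → ℝ} (e0 : e 0 = 1) (he : ∀ j, e (j + 1) = -(z * q ^ j) * e j) :
    Summable e := by
  have z0 : 0 < z := h0.trans hqz
  have h1 : q < 1 := hqz.trans hz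
  have hqz' : q / z < 1 := (div_lt_one z0).2 hqz
  have hd : 0 < q / z := div_pos h0 z0
  refine Summable.of_nat_of_neg ?_ ?_
  · refine (summable_geometric_of_lt_one z0.le hz).of_norm_bounded fun n => ?_
    induction n with
    | zero => simp [e0]
    | succ n ih =>
      rw [Nat.cast_succ, he, norm_mul, norm_neg, zpow_natCast, Real.norm_of_nonneg (by positivity),
        pow_succ, mul_comm (z ^ n)]
      exact mul_le_mul (mul_le_of_le_one_right z0.le (pow_le_one₀ h0.le h1.le)) ih
        (norm_nonneg _) z0.le
  · refine (summable_geometric_of_lt_one hd.le hqz').of_norm_bounded fun n => ?_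
    induction n with
    | zero => simp [e0]
    | succ n ih =>
      have h := he (-((n : ℤ) + 1))
      rw [show -((n : ℤ) + 1) + 1 = -n by ring, zpow_neg, zpow_add_one₀ h0.ne', zpow_natCast] at h
      have h2 : e (-((n : ℤ) + 1)) = -(q / z * q ^ n) * e (-n) := by
        rw [h]
        field_simp
      rw [Nat.cast_succ, h2, norm_mul, norm_neg, Real.norm_of_nonneg (by positivity),
        pow_succ, mul_comm ((q / z) ^ n)]
      exact mul_le_mul (mul_le_of_le_one_right hd.le (pow_le_one₀ h0.le h1.le)) ih
        (norm_nonneg _) hd.le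

/-- The Jacobi triple product, with `l` the value of the Euler function at `q`. -/
theorem tendsto_prod_jacobi {q z l : ℝ} (h0 : 0 < q) (hqz : q < z) (hz : z < 1)
    (hl : Tendsto (eulerProd q) atTop (𝓝 l)) (l0 : 0 < l)
    {e : ℤ → ℝ} (e0 : e 0 = 1) (he : ∀ j, e (j + 1) = -(z * q ^ j) * e j) :
    Tendsto (fun n => ∏ i ∈ range n, ((1 - z * q ^ i) * (1 - q ^ (i + 1) / z))) atTop
      (𝓝 (l⁻¹ * ∑' j, e j)) := by
  have z0 : 0 < z := h0.trans hqz
  have h1 : q < 1 := hqz.trans hz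
  simp_rw [← fun n => (hasSum_finite_jacobi h0 h1 z0.ne' e0 he n).tsum_eq]
  rw [← tsum_mul_left]
  have hs := summable_of_jacobi_recursion h0 hqz hz e0 he
  refine tendsto_tsum_of_dominated_convergence (hs.norm.mul_left (l⁻¹ * l⁻¹)) (fun j => ?_)
    (Eventually.of_forall fun n j => ?_)
  · have t : Tendsto (fun n : ℕ => (n : ℤ)) atTop atTop := tendsto_natCast_atTop_atTop
    have t1 := tendsto_invEulerProd hl l0 (fun n => n - j) (tendsto_atTop_add_const_right _ (-j) t)
    have t2 := tendsto_invEulerProd hl l0 (fun n => n + j) (tendsto_atTop_add_const_right _ j t)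
    have t3 := hl.comp (tendsto_id.const_mul_atTop' (r := 2) two_pos)
    rw [show l⁻¹ * e j = l * (l⁻¹ * l⁻¹) * e j by field_simp]
    exact (t3.mul (t1.mul t2)).mul_const (e j)
  · rw [norm_mul]
    refine mul_le_mul_of_nonneg_right ?_ (norm_nonneg _)
    have i1 := invEulerProd_nonneg h0 h1 (n - j)
    have i2 := invEulerProd_nonneg h0 h1 (n + j)
    have hp := (eulerProd_pos h0 h1 (2 * n)).le
    rw [Real.norm_of_nonneg (by positivity)]
    exact (mul_le_of_le_one_left (by positivity) (eulerProd_le_one h0 h1 _)).trans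
      (mul_le_mul (invEulerProd_le h0 h1 hl l0 _) (invEulerProd_le h0 h1 hl l0 _) i2
        (inv_pos.2 l0).le)

/-- The common factor of the terms of the Rogers series. -/
noncomputable def rogersFactor (q : ℝ) (k r : ℕ) : ℝ :=
  (-1) ^ r * q ^ (2 * k * r + r * (5 * r + 1) / 2) * (eulerProd q (k + r) / eulerProd q r)

/-- The `k`-th Rogers series; the continued fraction arises from
`rogersSeries q k = rogersSeries q (k + 1) + q ^ (k + 1) * rogersSeries q (k + 2)`. -/
noncomputable def rogersSeries (q : ℝ) (k : ℕ) : ℝ :=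
  ∑' r, rogersFactor q k r * (1 - q ^ (2 * k + 2 + 4 * r))

theorem pentagonal_exponent_succ (r : ℕ) :
    (r + 1) * (5 * (r + 1) + 1) / 2 = r * (5 * r + 1) / 2 + (5 * r + 3) := by
  rw [show (r + 1) * (5 * (r + 1) + 1) = r * (5 * r + 1) + (5 * r + 3) * 2 by ring,
    Nat.add_mul_div_right _ _ two_pos]

theorem rogersFactor_succ_left (q : ℝ) (k r : ℕ) :
    rogersFactor q (k + 1) r =
      rogersFactor q k r * ((q ^ r) ^ 2 * (1 - q ^ (k + 1) * q ^ r)) := by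
  rw [rogersFactor, rogersFactor, show k + 1 + r = k + r + 1 by ring, eulerProd_succ,
    show k + r + 1 = k + 1 + r by ring]
  ring

theorem rogersFactor_succ_right {q : ℝ} (h0 : 0 < q) (h1 : q < 1) (k r : ℕ) :
    rogersFactor q k (r + 1) * (1 - q * q ^ r) =
      -(rogersFactor q k r *
        ((q ^ (k + 1)) ^ 2 * q * (q ^ r) ^ 5 * (1 - q ^ (k + 1) * q ^ r))) := by
  have p := (eulerProd_pos h0 h1 r).ne'
  have p' : 1 - q * q ^ r ≠ 0 := by
    simpa [pow_succ, mul_comm] using (one_sub_pow_succ_pos h0 h1 r).ne'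
  rw [rogersFactor, rogersFactor, ← add_assoc, eulerProd_succ, eulerProd_succ,
    pentagonal_exponent_succ, show q ^ (r + 1) = q * q ^ r by ring,
    show q ^ (k + r + 1) = q ^ (k + 1) * q ^ r by ring]
  generalize 1 - q * q ^ r = d at *
  field_simp
  ring

theorem abs_rogersFactor_le {q : ℝ} (h0 : 0 < q) (h1 : q < 1) (k r : ℕ) :
    |rogersFactor q k r| ≤ q ^ r := by
  have p := eulerProd_pos h0 h1 r
  have p' := eulerProd_pos h0 h1 (k + r)
  rw [rogersFactor, abs_mul, abs_mul, abs_neg_one_pow, one_mul, abs_of_pos (by positivity),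
    abs_of_pos (by positivity)]
  refine (mul_le_of_le_one_right (by positivity)
    ((div_le_one p).2 (antitone_eulerProd h0 h1 (Nat.le_add_left r k)))).trans
    (pow_le_pow_of_le_one h0.le h1.le ?_)
  have : r ≤ r * (5 * r + 1) / 2 := by
    rw [Nat.le_div_iff_mul_le two_pos]
    rcases r.eq_zero_or_pos with rfl | h
    · simp
    · exact Nat.mul_le_mul_left r (by omega)
  omega

theorem abs_rogersFactor_mul_le {q : ℝ} (h0 : 0 < q) (h1 : q < 1) (k r : ℕ) {x : ℝ}
    (hx0 : 0 ≤ x) (hx1 : x ≤ 1) : |rogersFactor q k r * x| ≤ q ^ r := by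
  rw [abs_mul, abs_of_nonneg hx0]
  exact (mul_le_of_le_one_right (abs_nonneg _) hx1).trans (abs_rogersFactor_le h0 h1 k r)

theorem summable_rogersFactor_mul {q : ℝ} (h0 : 0 < q) (h1 : q < 1) (k : ℕ) {x : ℕ → ℝ}
    (hx0 : ∀ r, 0 ≤ x r) (hx1 : ∀ r, x r ≤ 1) :
    Summable fun r => rogersFactor q k r * x r :=
  (summable_geometric_of_lt_one h0.le h1).of_norm_bounded fun r =>
    abs_rogersFactor_mul_le h0 h1 k r (hx0 r) (hx1 r)

theorem one_sub_pow_mem {q : ℝ} (h0 : 0 < q) (h1 : q < 1) (n : ℕ) :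
    0 ≤ 1 - q ^ n ∧ 1 - q ^ n ≤ 1 :=
  ⟨sub_nonneg.2 (pow_le_one₀ h0.le h1.le), by linarith [pow_pos h0 n]⟩

theorem abs_rogersSeries_le {q : ℝ} (h0 : 0 < q) (h1 : q < 1) (k : ℕ) :
    |rogersSeries q k| ≤ (1 - q)⁻¹ := by
  rw [rogersSeries, ← Real.norm_eq_abs]
  exact tsum_of_norm_bounded (hasSum_geometric_of_lt_one h0.le h1) fun r =>
    abs_rogersFactor_mul_le h0 h1 k r (one_sub_pow_mem h0 h1 _).1 (one_sub_pow_mem h0 h1 _).2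

theorem tsum_eq_tsum_of_sub_eq_sub_succ {f f' g : ℕ → ℝ} (hf : Summable f) (hf' : Summable f')
    (hg : Summable g) (g0 : g 0 = 0) (h : ∀ r, f r - f' r = g r - g (r + 1)) :
    ∑' r, f r = ∑' r, f' r := by
  have h1 := hg.tsum_eq_zero_add
  have h2 : ∑' r, (f r - f' r) = ∑' r, (g r - g (r + 1)) := tsum_congr h
  rw [hf.tsum_sub hf', hg.tsum_sub ((summable_nat_add_iff 1).2 hg)] at h2
  linarith

theorem summable_rogersFactor_mul_pow_mul {q : ℝ} (h0 : 0 < q) (h1 : q < 1) (k : ℕ) :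
    Summable fun r => rogersFactor q k r * (q ^ r * (1 - q ^ (k + 1 + 2 * r))) :=
  summable_rogersFactor_mul h0 h1 k
    (fun r => mul_nonneg (by positivity) (one_sub_pow_mem h0 h1 _).1)
    (fun r => mul_le_one₀ (pow_le_one₀ h0.le h1.le) (one_sub_pow_mem h0 h1 _).1
      (one_sub_pow_mem h0 h1 _).2)

theorem summable_rogersSeries {q : ℝ} (h0 : 0 < q) (h1 : q < 1) (k : ℕ) :
    Summable fun r => rogersFactor q k r * (1 - q ^ (2 * k + 2 + 4 * r)) :=
  summable_rogersFactor_mul h0 h1 k (fun _ => (one_sub_pow_mem h0 h1 _).1)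
    (fun _ => (one_sub_pow_mem h0 h1 _).2)

theorem rogersSeries_succ_eq {q : ℝ} (h0 : 0 < q) (h1 : q < 1) (k : ℕ) :
    rogersSeries q (k + 1) =
      ∑' r, rogersFactor q k r * (q ^ r * (1 - q ^ (k + 1 + 2 * r))) := by
  refine (tsum_eq_tsum_of_sub_eq_sub_succ
    (g := fun r => rogersFactor q k r * (q ^ r * (1 - q ^ r)))
    (summable_rogersFactor_mul_pow_mul h0 h1 k)
    (summable_rogersSeries h0 h1 (k + 1)) ?_ (by simp) fun r => ?_).symm
  · exact summable_rogersFactor_mul h0 h1 k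
      (fun r => mul_nonneg (by positivity) (one_sub_pow_mem h0 h1 _).1)
      (fun r => mul_le_one₀ (pow_le_one₀ h0.le h1.le) (one_sub_pow_mem h0 h1 _).1
        (one_sub_pow_mem h0 h1 _).2)
  · have h := rogersFactor_succ_right h0 h1 k r
    rw [rogersFactor_succ_left]
    linear_combination (q * q ^ r) * h

theorem rogersSeries_eq {q : ℝ} (h0 : 0 < q) (h1 : q < 1) (k : ℕ) :
    rogersSeries q k = rogersSeries q (k + 1) + q ^ (k + 1) * rogersSeries q (k + 2) := by
  have s1 := summable_rogersFactor_mul_pow_mul h0 h1 k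
  have s2 := (summable_rogersFactor_mul_pow_mul h0 h1 (k + 1)).mul_left (q ^ (k + 1))
  rw [rogersSeries_succ_eq h0 h1, rogersSeries_succ_eq h0 h1, ← tsum_mul_left, ← s1.tsum_add s2]
  refine tsum_eq_tsum_of_sub_eq_sub_succ
    (g := fun r => rogersFactor q k r * (1 - q ^ r)) (summable_rogersSeries h0 h1 k)
    (s1.add s2) ?_ (by simp) fun r => ?_
  · exact summable_rogersFactor_mul h0 h1 k (fun _ => (one_sub_pow_mem h0 h1 _).1)
      (fun _ => (one_sub_pow_mem h0 h1 _).2)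
  · have h := rogersFactor_succ_right h0 h1 k r
    rw [rogersFactor_succ_left]
    linear_combination h

theorem rogersRamanujanGCF_nums_add_two (q : ℝ) (n : ℕ) :
    (rogersRamanujanGCF q).nums (n + 2) =
      (rogersRamanujanGCF q).nums (n + 1) + q ^ (n + 1) * (rogersRamanujanGCF q).nums n := by
  have h : (rogersRamanujanGCF q).s.get? (n + 1) = some ⟨q ^ (n + 1), 1⟩ := rfl
  simpa using GenContFract.nums_recurrence h rfl rfl

theorem rogersRamanujanGCF_dens_add_two (q : ℝ) (n : ℕ) :
    (rogersRamanujanGCF q).dens (n + 2) =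
      (rogersRamanujanGCF q).dens (n + 1) + q ^ (n + 1) * (rogersRamanujanGCF q).dens n := by
  have h : (rogersRamanujanGCF q).s.get? (n + 1) = some ⟨q ^ (n + 1), 1⟩ := rfl
  simpa using GenContFract.dens_recurrence h rfl rfl

theorem rogersRamanujanGCF_nums_one (q : ℝ) : (rogersRamanujanGCF q).nums 1 = 1 := by
  have h : (rogersRamanujanGCF q).s.get? 0 = some ⟨q ^ 0, 1⟩ := rfl
  rw [GenContFract.first_num_eq h]
  simp [rogersRamanujanGCF]

theorem rogersRamanujanGCF_dens_one (q : ℝ) : (rogersRamanujanGCF q).dens 1 = 1 := by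
  have h : (rogersRamanujanGCF q).s.get? 0 = some ⟨q ^ 0, 1⟩ := rfl
  simp [GenContFract.first_den_eq h]

theorem one_le_rogersRamanujanGCF_dens {q : ℝ} (h0 : 0 < q) (n : ℕ) :
    1 ≤ (rogersRamanujanGCF q).dens n := by
  induction n using Nat.twoStepInduction with
  | zero => simp
  | one => rw [rogersRamanujanGCF_dens_one]
  | more n h h' =>
    rw [rogersRamanujanGCF_dens_add_two]
    nlinarith [pow_pos h0 (n + 1)]

theorem rogersSeries_mul_dens_sub {q : ℝ} (h0 : 0 < q) (h1 : q < 1) (n : ℕ) :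
    rogersSeries q 1 * (rogersRamanujanGCF q).dens n -
      rogersSeries q 0 * (rogersRamanujanGCF q).nums n =
      (∏ i ∈ range n, -q ^ (i + 1)) * rogersSeries q (n + 1) := by
  induction n using Nat.twoStepInduction with
  | zero => simp [rogersRamanujanGCF]
  | one =>
    have h := rogersSeries_eq h0 h1 0
    simp only [rogersRamanujanGCF_nums_one, rogersRamanujanGCF_dens_one, prod_range_one]
    linear_combination -h
  | more n h h' =>
    have hu := rogersSeries_eq h0 h1 (n + 1)
    rw [rogersRamanujanGCF_nums_add_two, rogersRamanujanGCF_dens_add_two, prod_range_succ,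
      prod_range_succ]
    rw [prod_range_succ] at h'
    linear_combination h' + q ^ (n + 1) * h + (∏ i ∈ range n, -q ^ (i + 1)) * q ^ (n + 1) * hu

theorem tendsto_rogersRamanujanGCF_convs {q : ℝ} (h0 : 0 < q) (h1 : q < 1)
    (hne : rogersSeries q 0 ≠ 0) :
    Tendsto (rogersRamanujanGCF q).convs atTop (𝓝 (rogersSeries q 1 / rogersSeries q 0)) := by
  have hp (n : ℕ) : |∏ i ∈ range n, -q ^ (i + 1)| ≤ q ^ n := by
    rw [abs_prod, ← card_range n, ← prod_const, card_range]
    refine prod_le_prod (fun _ _ => abs_nonneg _) fun i _ => ?_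
    rw [abs_neg, abs_of_pos (by positivity)]
    exact pow_le_of_le_one h0.le h1.le i.succ_ne_zero
  refine tendsto_iff_norm_sub_tendsto_zero.2 ?_
  have hlim := (tendsto_pow_atTop_nhds_zero_of_lt_one h0.le h1).mul_const
    ((1 - q)⁻¹ * |rogersSeries q 0|⁻¹)
  rw [zero_mul] at hlim
  refine squeeze_zero (fun _ => norm_nonneg _) (fun n => ?_) hlim
  have hd := one_le_rogersRamanujanGCF_dens h0 n
  have hd0 : (rogersRamanujanGCF q).dens n ≠ 0 := by positivity
  have hq : 0 < 1 - q := sub_pos.2 h1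
  have key : (rogersRamanujanGCF q).convs n - rogersSeries q 1 / rogersSeries q 0 =
      -((∏ i ∈ range n, -q ^ (i + 1)) * rogersSeries q (n + 1)) /
        (rogersSeries q 0 * (rogersRamanujanGCF q).dens n) := by
    rw [← rogersSeries_mul_dens_sub h0 h1, GenContFract.conv_eq_num_div_den]
    field_simp
    ring
  rw [key, Real.norm_eq_abs, abs_div, abs_neg, abs_mul, abs_mul, div_eq_mul_inv, mul_inv,
    ← mul_assoc (q ^ n)]
  refine mul_le_mul (mul_le_mul (hp n) (abs_rogersSeries_le h0 h1 _) (abs_nonneg _)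
    (by positivity)) (mul_le_of_le_one_right (by positivity) (inv_le_one_of_one_le₀ ?_))
    (by positivity) (by positivity)
  exact hd.trans (le_abs_self _)

/-- The terms of the theta series `∑ (-1) ^ j * z ^ j * q ^ (j * (j - 1) / 2)`. -/
noncomputable def thetaTerm (q z : ℝ) (j : ℤ) : ℝ := (-z) ^ j * q ^ (j * (j - 1) / 2)

theorem thetaTerm_zero (q z : ℝ) : thetaTerm q z 0 = 1 := by simp [thetaTerm]

theorem thetaTerm_add_one {q z : ℝ} (hq : q ≠ 0) (hz : z ≠ 0) (j : ℤ) :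
    thetaTerm q z (j + 1) = -(z * q ^ j) * thetaTerm q z j := by
  rw [thetaTerm, thetaTerm, show (j + 1) * (j + 1 - 1) = j * (j - 1) + j * 2 by ring,
    Int.add_mul_ediv_right _ _ two_ne_zero, zpow_add₀ hq, zpow_add_one₀ (neg_ne_zero.2 hz)]
  ring

theorem rogersFactor_zero_succ {q : ℝ} (h0 : 0 < q) (h1 : q < 1) (r : ℕ) :
    rogersFactor q 0 (r + 1) = -q ^ (5 * r + 3) * rogersFactor q 0 r := by
  simp only [rogersFactor, zero_add, mul_zero, zero_mul, pentagonal_exponent_succ,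
    div_self (eulerProd_pos h0 h1 _).ne']
  ring

theorem thetaTerm_natCast {q : ℝ} (h0 : 0 < q) (h1 : q < 1) (s r : ℕ) :
    thetaTerm (q ^ 5) (q ^ (s + 3)) r = rogersFactor q 0 r * q ^ (s * r) := by
  induction r with
  | zero => simp [thetaTerm, rogersFactor, eulerProd]
  | succ r ih =>
    rw [Nat.cast_succ, thetaTerm_add_one (by positivity) (by positivity), ih,
      rogersFactor_zero_succ h0 h1, zpow_natCast]
    ring

theorem thetaTerm_neg_natCast_add_one {q : ℝ} (h0 : 0 < q) (h1 : q < 1) {s t : ℕ}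
    (hst : s + t = 2) (r : ℕ) :
    thetaTerm (q ^ 5) (q ^ (s + 3)) (-(r + 1)) =
      -(rogersFactor q 0 r * q ^ (t + (t + 2) * r)) := by
  have step (j : ℕ) : thetaTerm (q ^ 5) (q ^ (s + 3)) (-(j + 1)) =
      -(q ^ (t + 5 * j) * thetaTerm (q ^ 5) (q ^ (s + 3)) (-j)) := by
    have h := thetaTerm_add_one (q := q ^ 5) (z := q ^ (s + 3)) (by positivity) (by positivity)
      (-((j : ℤ) + 1))
    rw [show -((j : ℤ) + 1) + 1 = -j by ring, zpow_neg, ← Nat.cast_succ, zpow_natCast,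
      Nat.cast_succ] at h
    have hexp : (q ^ 5) ^ (j + 1) = q ^ (s + 3) * q ^ (t + 5 * j) := by
      rw [← pow_mul, ← pow_add]
      congr 1
      omega
    rw [h, Nat.succ_eq_add_one, hexp]
    field_simp
  induction r with
  | zero => simpa [thetaTerm_zero, rogersFactor, eulerProd] using step 0
  | succ r ih =>
    rw [step (r + 1), Nat.cast_succ, ih, rogersFactor_zero_succ h0 h1]
    ring

theorem hasSum_thetaTerm {q : ℝ} (h0 : 0 < q) (h1 : q < 1) {s t : ℕ} (hst : s + t = 2)
    (ht : t ≠ 0) :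
    HasSum (fun r : ℕ => rogersFactor q 0 r * (q ^ (s * r) - q ^ (t + (t + 2) * r)))
      (∑' j, thetaTerm (q ^ 5) (q ^ (s + 3)) j) := by
  have hs := summable_of_jacobi_recursion (q := q ^ 5) (z := q ^ (s + 3)) (by positivity)
    (pow_lt_pow_right_of_lt_one₀ h0 h1 (by omega)) (pow_lt_one₀ h0.le h1 (by omega))
    (thetaTerm_zero _ _) (thetaTerm_add_one (by positivity) (by positivity))
  refine hs.hasSum.nat_add_neg_add_one.congr_fun fun r => ?_
  rw [thetaTerm_natCast h0 h1, thetaTerm_neg_natCast_add_one h0 h1 hst]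
  ring

theorem rogersSeries_zero_eq_tsum_thetaTerm {q : ℝ} (h0 : 0 < q) (h1 : q < 1) :
    rogersSeries q 0 = ∑' j, thetaTerm (q ^ 5) (q ^ 3) j := by
  rw [← (hasSum_thetaTerm h0 h1 (s := 0) (t := 2) rfl two_ne_zero).tsum_eq, rogersSeries]
  refine tsum_congr fun r => ?_
  ring

theorem rogersSeries_one_eq_tsum_thetaTerm {q : ℝ} (h0 : 0 < q) (h1 : q < 1) :
    rogersSeries q 1 = ∑' j, thetaTerm (q ^ 5) (q ^ 4) j := by
  rw [← (hasSum_thetaTerm h0 h1 (s := 1) (t := 1) rfl one_ne_zero).tsum_eq,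
    rogersSeries_succ_eq h0 h1]
  refine tsum_congr fun r => ?_
  ring

theorem prod_range_chi5 {q : ℝ} (h0 : 0 < q) (n : ℕ) :
    ∏ k ∈ range (5 * n), (1 - q ^ (k + 1)) ^ chi5 (k + 1) =
      (∏ i ∈ range n, ((1 - q ^ 4 * (q ^ 5) ^ i) * (1 - (q ^ 5) ^ (i + 1) / q ^ 4))) /
        ∏ i ∈ range n, ((1 - q ^ 3 * (q ^ 5) ^ i) * (1 - (q ^ 5) ^ (i + 1) / q ^ 3)) := by
  induction n with
  | zero => simp
  | succ n ih =>
    have c1 : chi5 (5 * n + 1) = 1 := by simp [chi5]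
    have c2 : chi5 (5 * n + 1 + 1) = -1 := by simp [chi5, add_assoc]
    have c3 : chi5 (5 * n + 1 + 1 + 1) = -1 := by simp [chi5, add_assoc]
    have c4 : chi5 (5 * n + 1 + 1 + 1 + 1) = 1 := by simp [chi5, add_assoc]
    have c5 : chi5 (5 * n + 1 + 1 + 1 + 1 + 1) = 0 := by simp [chi5, add_assoc]
    have d4 : (q ^ 5) ^ (n + 1) / q ^ 4 = q ^ (5 * n + 1) := by
      rw [div_eq_iff (by positivity)]
      ring
    have d3 : (q ^ 5) ^ (n + 1) / q ^ 3 = q ^ (5 * n + 1 + 1) := by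
      rw [div_eq_iff (by positivity)]
      ring
    rw [show 5 * (n + 1) = 5 * n + 1 + 1 + 1 + 1 + 1 by ring]
    simp only [prod_range_succ _ (5 * n + 1 + 1 + 1 + 1), prod_range_succ _ (5 * n + 1 + 1 + 1),
      prod_range_succ _ (5 * n + 1 + 1), prod_range_succ _ (5 * n + 1), prod_range_succ _ (5 * n),
      prod_range_succ _ n]
    rw [ih, c1, c2, c3, c4, c5, d3, d4,
      show q ^ 4 * (q ^ 5) ^ n = q ^ (5 * n + 1 + 1 + 1 + 1) by ring,
      show q ^ 3 * (q ^ 5) ^ n = q ^ (5 * n + 1 + 1 + 1) by ring, zpow_one, zpow_one, zpow_neg_one,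
      zpow_neg_one, zpow_zero, mul_div_mul_comm, div_eq_mul_inv _ ((_ : ℝ) * _), mul_inv]
    ring

theorem multipliable_one_sub_pow_chi5 {q : ℝ} (h0 : 0 < q) (h1 : q < 1) :
    Multipliable fun n : ℕ => (1 - q ^ (n + 1)) ^ chi5 (n + 1) := by
  have hq : 0 < 1 - q := sub_pos.2 h1
  have hs : Summable fun n : ℕ => ‖(1 - q ^ (n + 1)) ^ chi5 (n + 1) - 1‖ := by
    refine (((summable_nat_add_iff 1).2 (summable_geometric_of_lt_one h0.le h1)).div_const
      (1 - q)).of_nonneg_of_le (fun _ => norm_nonneg _) fun n => ?_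
    have hx : 0 < q ^ (n + 1) := by positivity
    have hxq : q ^ (n + 1) ≤ q := pow_le_of_le_one h0.le h1.le n.succ_ne_zero
    have hp := one_sub_pow_succ_pos h0 h1 n
    unfold chi5
    split_ifs
    · rw [zpow_one, sub_sub_cancel_left, norm_neg, Real.norm_of_nonneg hx.le]
      exact le_div_self hx.le hq (by linarith)
    · rw [zpow_neg_one, show (1 - q ^ (n + 1))⁻¹ - 1 = q ^ (n + 1) / (1 - q ^ (n + 1)) by
        field_simp; ring, Real.norm_of_nonneg (by positivity)]
      exact div_le_div_of_nonneg_left hx.le hq (by linarith)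
    · simp only [zpow_zero, sub_self, norm_zero]
      positivity
  simpa using multipliable_one_add_of_summable hs

theorem exists_pos_tendsto_prod_theta {q z : ℝ} (h0 : 0 < q) (hqz : q < z) (hz : z < 1) :
    ∃ l, 0 < l ∧ Tendsto (fun n => ∏ i ∈ range n, ((1 - z * q ^ i) * (1 - q ^ (i + 1) / z)))
      atTop (𝓝 l) := by
  have z0 : 0 < z := h0.trans hqz
  have h1 : q < 1 := hqz.trans hz
  have hs := summable_geometric_of_lt_one h0.le h1
  obtain ⟨a, a0, ha⟩ := exists_pos_tendsto_prod_one_sub (hs.mul_left z) fun n =>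
    (mul_le_of_le_one_right z0.le (pow_le_one₀ h0.le h1.le)).trans_lt hz
  obtain ⟨b, b0, hb⟩ := exists_pos_tendsto_prod_one_sub
    (((summable_nat_add_iff 1).2 hs).div_const z) fun n =>
      (div_lt_one z0).2 ((pow_le_of_le_one h0.le h1.le n.succ_ne_zero).trans_lt hqz)
  refine ⟨a * b, mul_pos a0 b0, ?_⟩
  simpa only [prod_mul_distrib] using ha.mul hb

theorem rogersRamanujan_gcf_eq_prod (q : ℝ) (hq0 : 0 < q) (hq1 : q < 1) :
    Filter.Tendsto (rogersRamanujanGCF q).convs Filter.atTop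
      (nhds (∏' n : ℕ, (1 - q ^ (n + 1)) ^ chi5 (n + 1))) := by
  have p5 : 0 < q ^ 5 := by positivity
  have p53 : q ^ 5 < q ^ 3 := pow_lt_pow_right_of_lt_one₀ hq0 hq1 (by norm_num)
  have p54 : q ^ 5 < q ^ 4 := pow_lt_pow_right_of_lt_one₀ hq0 hq1 (by norm_num)
  have p3 : q ^ 3 < 1 := pow_lt_one₀ hq0.le hq1 three_ne_zero
  have p4 : q ^ 4 < 1 := pow_lt_one₀ hq0.le hq1 four_ne_zero
  obtain ⟨l, l0, hl⟩ := exists_pos_tendsto_eulerProd p5 (p53.trans p3)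
  have t3 := tendsto_prod_jacobi p5 p53 p3 hl l0 (thetaTerm_zero _ _)
    (thetaTerm_add_one p5.ne' (by positivity))
  have t4 := tendsto_prod_jacobi p5 p54 p4 hl l0 (thetaTerm_zero _ _)
    (thetaTerm_add_one p5.ne' (by positivity))
  rw [← rogersSeries_zero_eq_tsum_thetaTerm hq0 hq1] at t3
  rw [← rogersSeries_one_eq_tsum_thetaTerm hq0 hq1] at t4
  obtain ⟨a, a0, ha⟩ := exists_pos_tendsto_prod_theta p5 p53 p3
  have hne : l⁻¹ * rogersSeries q 0 ≠ 0 := tendsto_nhds_unique ha t3 ▸ a0.ne'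
  have hprod := (multipliable_one_sub_pow_chi5 hq0 hq1).tendsto_prod_tprod_nat.comp
    (tendsto_id.const_mul_atTop' (r := 5) (by norm_num))
  have hdiv := t4.div t3 hne
  rw [mul_div_mul_left _ _ (inv_ne_zero l0.ne')] at hdiv
  rw [tendsto_nhds_unique hprod (hdiv.congr fun n => (prod_range_chi5 hq0 n).symm)]
  exact tendsto_rogersRamanujanGCF_convs hq0 hq1 (right_ne_zero_of_mul hne)
end

section
/- For every real number q with 0 < q < 1, one has 1/R(q) − 1 − R(q) = f(−q^{1/5}) / (q^{1/5} · f(−q⁵)), where R(q) = q^{1/5} ∏_{n=1}^∞ (1 − qⁿ)^{χ₅(n)} and f(−q) = ∏_{n=1}^∞ (1 − qⁿ). -/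
/-- The Rogers–Ramanujan continued fraction, given by its product representation
`R(q) = q^{1/5} ∏_{n=1}^∞ (1 - q^n)^{χ₅(n)}`. -/
noncomputable def RR (q : ℝ) : ℝ :=
  q ^ ((1 : ℝ) / 5) * ∏' n : ℕ, (1 - q ^ (n + 1)) ^ chi5 (n + 1)

/-- Ramanujan's function `f(-q) = ∏_{n=1}^∞ (1 - q^n)`. -/
noncomputable def ramanujanF (q : ℝ) : ℝ :=
  ∏' n : ℕ, (1 - q ^ (n + 1))

open Filter Topology Finset

namespace RogersRamanujan

/-- The infinite `q`-Pochhammer symbol `(c; y)_∞ = ∏_{n ≥ 0} (1 - c yⁿ)`. -/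
noncomputable def qPoch (c y : ℝ) : ℝ := ∏' n : ℕ, (1 - c * y ^ n)

/-- The theta series `∑_{n ∈ ℤ} wⁿ x^{n²}`. -/
noncomputable def theta (x w : ℝ) : ℝ := ∑' n : ℤ, w ^ n * x ^ (n ^ 2)

section Products

lemma summable_norm_mul_pow (c : ℝ) {y : ℝ} (hy0 : 0 < y) (hy1 : y < 1) :
    Summable fun n : ℕ ↦ ‖-(c * y ^ n)‖ := by
  simp only [norm_neg, norm_mul, norm_pow, Real.norm_of_nonneg hy0.le]
  exact (summable_geometric_of_lt_one hy0.le hy1).mul_left _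

lemma multipliable_one_sub_mul_pow (c : ℝ) {y : ℝ} (hy0 : 0 < y) (hy1 : y < 1) :
    Multipliable fun n : ℕ ↦ 1 - c * y ^ n := by
  simpa only [sub_eq_add_neg] using
    multipliable_one_add_of_summable (summable_norm_mul_pow c hy0 hy1)

lemma tendsto_qPoch (c : ℝ) {y : ℝ} (hy0 : 0 < y) (hy1 : y < 1) :
    Tendsto (fun N ↦ ∏ n ∈ range N, (1 - c * y ^ n)) atTop (𝓝 (qPoch c y)) :=
  (multipliable_one_sub_mul_pow c hy0 hy1).tendsto_prod_tprod_nat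

lemma one_sub_mul_pow_pos {c y : ℝ} (hc : c < 1) (hy0 : 0 < y) (hy1 : y < 1) (n : ℕ) :
    0 < 1 - c * y ^ n := by
  have h1 : y ^ n ≤ 1 := pow_le_one₀ hy0.le hy1.le
  have h2 : 0 < y ^ n := pow_pos hy0 n
  rcases le_or_gt c 0 with h | h <;> nlinarith

lemma qPoch_ne_zero {c y : ℝ} (hc : c < 1) (hy0 : 0 < y) (hy1 : y < 1) : qPoch c y ≠ 0 := by
  have := tprod_one_add_ne_zero_of_summable (f := fun n : ℕ ↦ -(c * y ^ n))
    (fun n ↦ by simpa [← sub_eq_add_neg] using (one_sub_mul_pow_pos hc hy0 hy1 n).ne')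
    (summable_norm_mul_pow c hy0 hy1)
  simpa only [qPoch, sub_eq_add_neg] using this

lemma qPoch_pos {c y : ℝ} (hc : c < 1) (hy0 : 0 < y) (hy1 : y < 1) : 0 < qPoch c y :=
  lt_of_le_of_ne (ge_of_tendsto' (tendsto_qPoch c hy0 hy1) fun _ ↦
    prod_nonneg fun n _ ↦ (one_sub_mul_pow_pos hc hy0 hy1 n).le) (qPoch_ne_zero hc hy0 hy1).symm

lemma prod_range_mul_eq (f : ℕ → ℝ) (k N : ℕ) :
    ∏ n ∈ range (k * N), f n = ∏ i ∈ range N, ∏ r ∈ range k, f (k * i + r) := by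
  induction N with
  | zero => simp
  | succ N ih => rw [mul_add_one, prod_range_add, ih, prod_range_succ]

lemma tendsto_prod_blocks {f : ℕ → ℝ} {l : ℝ} {k : ℕ} (hk : 0 < k)
    (hf : Tendsto (fun N ↦ ∏ n ∈ range N, f n) atTop (𝓝 l)) :
    Tendsto (fun N ↦ ∏ i ∈ range N, ∏ r ∈ range k, f (k * i + r)) atTop (𝓝 l) := by
  simpa only [Function.comp_def, prod_range_mul_eq, id] using
    hf.comp (tendsto_id.const_mul_atTop' hk)

lemma qPoch_split (c : ℝ) {y : ℝ} (hy0 : 0 < y) (hy1 : y < 1) {k : ℕ} (hk : 0 < k) :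
    qPoch c y = ∏ r ∈ range k, qPoch (c * y ^ r) (y ^ k) := by
  refine tendsto_nhds_unique (tendsto_prod_blocks hk (tendsto_qPoch c hy0 hy1)) ?_
  have := tendsto_finsetProd (range k) fun r _ ↦
    tendsto_qPoch (c * y ^ r) (pow_pos hy0 k) (pow_lt_one₀ hy0.le hy1 hk.ne')
  convert this using 2 with N
  rw [Finset.prod_comm]
  refine prod_congr rfl fun r _ ↦ prod_congr rfl fun i _ ↦ ?_
  ring

lemma qPoch_sq (c : ℝ) {y : ℝ} (hy0 : 0 < y) (hy1 : y < 1) :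
    qPoch (c ^ 2) (y ^ 2) = qPoch c y * qPoch (-c) y := by
  refine tendsto_nhds_unique (tendsto_qPoch _ (pow_pos hy0 2) (pow_lt_one₀ hy0.le hy1 two_ne_zero))
    (((tendsto_qPoch c hy0 hy1).mul (tendsto_qPoch (-c) hy0 hy1)).congr fun N ↦ ?_)
  rw [← prod_mul_distrib]
  refine prod_congr rfl fun i _ ↦ ?_
  ring

end Products

section TripleProduct

lemma summable_nat_theta {x : ℝ} (hx0 : 0 < x) (hx1 : x < 1) {w : ℝ} (hw : w ≠ 0) :
    Summable fun n : ℕ ↦ w ^ n * x ^ (n ^ 2) := by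
  refine summable_of_ratio_test_tendsto_lt_one zero_lt_one
    (Eventually.of_forall fun n ↦ mul_ne_zero (pow_ne_zero _ hw) (pow_ne_zero _ hx0.ne')) ?_
  have h : Tendsto (fun n : ℕ ↦ |w| * x * (x ^ 2) ^ n) atTop (𝓝 (|w| * x * 0)) :=
    (tendsto_pow_atTop_nhds_zero_of_lt_one (by positivity)
      (pow_lt_one₀ hx0.le hx1 two_ne_zero)).const_mul _
  rw [mul_zero] at h
  refine h.congr fun n ↦ ?_
  have : |w| ≠ 0 := by simpa using hw
  simp only [norm_mul, norm_pow, Real.norm_eq_abs, abs_of_pos hx0]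
  field_simp
  ring

lemma summable_theta {x : ℝ} (hx0 : 0 < x) (hx1 : x < 1) {w : ℝ} (hw : w ≠ 0) :
    Summable fun n : ℤ ↦ w ^ n * x ^ (n ^ 2) := by
  refine Summable.of_nat_of_neg ?_ ?_
  · exact_mod_cast summable_nat_theta hx0 hx1 hw
  · have := summable_nat_theta hx0 hx1 (inv_ne_zero hw)
    refine this.congr fun n ↦ ?_
    rw [neg_sq, zpow_neg, inv_pow]
    norm_cast

/-- The reciprocal of `∏_{i < k} (1 - q^{i+1})`, extended by zero to negative `k`. -/
noncomputable def invQFactorial (q : ℝ) (k : ℤ) : ℝ :=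
  if 0 ≤ k then (∏ i ∈ range k.toNat, (1 - q * q ^ i))⁻¹ else 0

lemma prod_one_sub_pos {q : ℝ} (hq0 : 0 < q) (hq1 : q < 1) (k : ℕ) :
    0 < ∏ i ∈ range k, (1 - q * q ^ i) :=
  prod_pos fun i _ ↦ one_sub_mul_pow_pos hq1 hq0 hq1 i

lemma prod_one_sub_le_one {q : ℝ} (hq0 : 0 < q) (hq1 : q < 1) (k : ℕ) :
    ∏ i ∈ range k, (1 - q * q ^ i) ≤ 1 :=
  prod_le_one (fun i _ ↦ (one_sub_mul_pow_pos hq1 hq0 hq1 i).le) fun i _ ↦ by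
    have : 0 < q * q ^ i := by positivity
    linarith

lemma qPoch_le_prod_one_sub {q : ℝ} (hq0 : 0 < q) (hq1 : q < 1) (k : ℕ) :
    qPoch q q ≤ ∏ i ∈ range k, (1 - q * q ^ i) := by
  refine Antitone.le_of_tendsto (antitone_nat_of_succ_le fun n ↦ ?_) (tendsto_qPoch q hq0 hq1) k
  rw [prod_range_succ]
  refine mul_le_of_le_one_right (prod_one_sub_pos hq0 hq1 n).le ?_
  have : 0 < q * q ^ n := by positivity
  linarith

lemma invQFactorial_nonneg {q : ℝ} (hq0 : 0 < q) (hq1 : q < 1) (k : ℤ) :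
    0 ≤ invQFactorial q k := by
  unfold invQFactorial
  split_ifs
  · exact (inv_pos.mpr (prod_one_sub_pos hq0 hq1 _)).le
  · rfl

lemma invQFactorial_le {q : ℝ} (hq0 : 0 < q) (hq1 : q < 1) (k : ℤ) :
    invQFactorial q k ≤ (qPoch q q)⁻¹ := by
  have hP := qPoch_pos hq1 hq0 hq1
  unfold invQFactorial
  split_ifs
  · exact inv_anti₀ hP (qPoch_le_prod_one_sub hq0 hq1 _)
  · exact (inv_pos.mpr hP).le

lemma invQFactorial_sub_one {q : ℝ} (hq0 : 0 < q) (hq1 : q < 1) (k : ℤ) :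
    invQFactorial q (k - 1) = (1 - q ^ k) * invQFactorial q k := by
  rcases lt_trichotomy k 0 with hk | rfl | hk
  · simp [invQFactorial, not_le.mpr hk, show ¬ (1 ≤ k) by lia]
  · simp [invQFactorial]
  · obtain ⟨n, rfl⟩ : ∃ n : ℕ, k = n + 1 := ⟨(k - 1).toNat, by lia⟩
    have h1 : 1 - q * q ^ n ≠ 0 := (one_sub_mul_pow_pos hq1 hq0 hq1 n).ne'
    have h2 : (1 : ℝ) - q ^ ((n : ℤ) + 1) = 1 - q * q ^ n := by
      rw [← pow_succ']
      norm_cast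
    have h3 : ((n : ℤ) + 1).toNat = n + 1 := by lia
    rw [h2, invQFactorial, invQFactorial, if_pos (by lia), if_pos (by lia), h3,
      add_sub_cancel_right, Int.toNat_natCast, prod_range_succ, mul_inv]
    field_simp

lemma tendsto_invQFactorial {q : ℝ} (hq0 : 0 < q) (hq1 : q < 1) :
    Tendsto (invQFactorial q) atTop (𝓝 (qPoch q q)⁻¹) := by
  have h := ((tendsto_qPoch q hq0 hq1).inv₀ (qPoch_ne_zero hq1 hq0 hq1)).comp
    (tendsto_atTop_atTop.2 fun b : ℕ ↦
      ⟨(b : ℤ), fun (a : ℤ) (h : (b : ℤ) ≤ a) ↦ (by lia : b ≤ a.toNat)⟩)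
  refine h.congr' ?_
  filter_upwards [eventually_ge_atTop 0] with k hk
  simp [invQFactorial, hk]

/-- The coefficient of `wʲ` in `∏_{k < n} (1 + w x^{2k+1}) (1 + w⁻¹ x^{2k+1})`. -/
noncomputable def tripleCoeff (x : ℝ) (n : ℕ) (j : ℤ) : ℝ :=
  (∏ i ∈ range (2 * n), (1 - x ^ 2 * (x ^ 2) ^ i)) *
    (invQFactorial (x ^ 2) (n - j) * invQFactorial (x ^ 2) (n + j)) * x ^ (j ^ 2)

lemma tripleCoeff_succ {x : ℝ} (hx0 : 0 < x) (hx1 : x < 1) (n : ℕ) (j : ℤ) :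
    tripleCoeff x (n + 1) j = (1 + x ^ (4 * n + 2)) * tripleCoeff x n j +
      x ^ (2 * n + 1) * (tripleCoeff x n (j - 1) + tripleCoeff x n (j + 1)) := by
  have hq0 : 0 < x ^ 2 := by positivity
  have hq1 : x ^ 2 < 1 := pow_lt_one₀ hx0.le hx1 two_ne_zero
  have hA := invQFactorial_sub_one hq0 hq1 (n + 1 - j)
  have hA' := invQFactorial_sub_one hq0 hq1 (n - j)
  have hB := invQFactorial_sub_one hq0 hq1 (n + 1 + j)
  have hB' := invQFactorial_sub_one hq0 hq1 (n + j)
  rw [show (n : ℤ) + 1 - j - 1 = n - j by ring] at hA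
  rw [show (n : ℤ) + 1 + j - 1 = n + j by ring] at hB
  rw [hA] at hA'
  rw [hB] at hB'
  simp only [tripleCoeff, Nat.cast_add, Nat.cast_one]
  rw [show (n : ℤ) - (j - 1) = n + 1 - j by ring, show (n : ℤ) + (j - 1) = n + j - 1 by ring,
    show (n : ℤ) - (j + 1) = n - j - 1 by ring, show (n : ℤ) + (j + 1) = n + 1 + j by ring,
    hA', hB', hA, hB, show 2 * (n + 1) = 2 * n + 1 + 1 by ring, prod_range_succ, prod_range_succ]
  generalize invQFactorial (x ^ 2) (n + 1 - j) = A
  generalize invQFactorial (x ^ 2) (n + 1 + j) = B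
  generalize ∏ i ∈ range (2 * n), (1 - x ^ 2 * (x ^ 2) ^ i) = C
  have hx := hx0.ne'
  have e1 (k : ℤ) : (x ^ 2) ^ k = (x ^ k) ^ 2 := by
    rw [← zpow_natCast, ← zpow_natCast, zpow_comm]
  have e2 : x ^ ((j - 1) ^ 2) = x ^ (j ^ 2) * x / (x ^ j) ^ 2 := by
    rw [show (j - 1) ^ 2 = j ^ 2 + 1 - (j + j) by ring, zpow_sub₀ hx, zpow_add_one₀ hx,
      zpow_add₀ hx, ← sq]
  have e3 : x ^ ((j + 1) ^ 2) = x ^ (j ^ 2) * x * (x ^ j) ^ 2 := by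
    rw [show (j + 1) ^ 2 = j ^ 2 + 1 + (j + j) by ring, zpow_add₀ hx, zpow_add_one₀ hx,
      zpow_add₀ hx, ← sq]
  have e4 : x ^ (4 * n + 2) = (x ^ n) ^ 4 * x ^ 2 := by ring
  have e5 : x ^ (2 * n + 1) = (x ^ n) ^ 2 * x := by ring
  have e6 (i : ℕ) : (x ^ 2) ^ (2 * n + i) = (x ^ n) ^ 4 * (x ^ 2) ^ i := by ring
  have e7 : (x ^ 2) ^ (2 * n) = (x ^ n) ^ 4 := by ring
  simp only [e1, e2, e3, e4, e5, e6, e7, zpow_add₀ hx, zpow_sub₀ hx, zpow_one, zpow_natCast]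
  have hX := zpow_ne_zero j hx
  generalize x ^ (j ^ 2) = G
  generalize x ^ j = X at *
  generalize x ^ n = Y
  field_simp
  ring

lemma hasSum_tripleCoeff {x : ℝ} (hx0 : 0 < x) (hx1 : x < 1) {w : ℝ} (hw : w ≠ 0) (n : ℕ) :
    HasSum (fun j : ℤ ↦ tripleCoeff x n j * w ^ j)
      (∏ k ∈ range n, ((1 + w * x ^ (2 * k + 1)) * (1 + w⁻¹ * x ^ (2 * k + 1)))) := by
  induction n with
  | zero =>
    convert hasSum_single (0 : ℤ) fun j hj ↦ ?_ using 1
    · simp [tripleCoeff, invQFactorial]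
    · rcases lt_or_gt_of_ne hj with h | h
      · simp [tripleCoeff, invQFactorial, not_le.mpr h]
      · simp [tripleCoeff, invQFactorial, not_le.mpr h]
  | succ n ih =>
    have h1 := ((Equiv.subRight (1 : ℤ)).hasSum_iff.mpr ih).mul_left (w * x ^ (2 * n + 1))
    have h2 := ((Equiv.addRight (1 : ℤ)).hasSum_iff.mpr ih).mul_left (w⁻¹ * x ^ (2 * n + 1))
    have h3 := ((ih.mul_left (1 + x ^ (4 * n + 2))).add h1).add h2
    rw [← add_mul, ← add_mul] at h3
    have h4 : 1 + x ^ (4 * n + 2) + w * x ^ (2 * n + 1) + w⁻¹ * x ^ (2 * n + 1) =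
        (1 + w * x ^ (2 * n + 1)) * (1 + w⁻¹ * x ^ (2 * n + 1)) := by
      field_simp
      ring
    rw [prod_range_succ, mul_comm, ← h4]
    refine h3.congr_fun fun j ↦ ?_
    simp only [Function.comp_apply, Equiv.subRight_apply, Equiv.coe_addRight,
      tripleCoeff_succ hx0 hx1, zpow_sub_one₀ hw, zpow_add_one₀ hw]
    field_simp
    ring

lemma tendsto_tripleCoeff {x : ℝ} (hx0 : 0 < x) (hx1 : x < 1) (j : ℤ) :
    Tendsto (tripleCoeff x · j) atTop (𝓝 ((qPoch (x ^ 2) (x ^ 2))⁻¹ * x ^ (j ^ 2))) := by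
  have hq0 : 0 < x ^ 2 := by positivity
  have hq1 : x ^ 2 < 1 := pow_lt_one₀ hx0.le hx1 two_ne_zero
  have hP := qPoch_ne_zero hq1 hq0 hq1
  have h1 := (tendsto_qPoch (x ^ 2) hq0 hq1).comp (tendsto_id.const_mul_atTop' two_pos)
  have h2 := (tendsto_invQFactorial hq0 hq1).comp
    (tendsto_atTop_add_const_right atTop (-j) (tendsto_natCast_atTop_atTop (R := ℤ)))
  have h3 := (tendsto_invQFactorial hq0 hq1).comp
    (tendsto_atTop_add_const_right atTop j (tendsto_natCast_atTop_atTop (R := ℤ)))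
  have h := (h1.mul (h2.mul h3)).mul_const (x ^ (j ^ 2))
  rw [mul_inv_cancel_left₀ hP] at h
  exact h

lemma norm_tripleCoeff_le {x : ℝ} (hx0 : 0 < x) (hx1 : x < 1) (n : ℕ) (j : ℤ) :
    ‖tripleCoeff x n j‖ ≤ (qPoch (x ^ 2) (x ^ 2))⁻¹ ^ 2 * x ^ (j ^ 2) := by
  have hq0 : 0 < x ^ 2 := by positivity
  have hq1 : x ^ 2 < 1 := pow_lt_one₀ hx0.le hx1 two_ne_zero
  have h0 := invQFactorial_nonneg hq0 hq1
  have h1 := (prod_one_sub_pos hq0 hq1 (2 * n)).le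
  rw [tripleCoeff, Real.norm_of_nonneg (mul_nonneg (mul_nonneg h1 (mul_nonneg (h0 _) (h0 _)))
    (by positivity)), sq (qPoch _ _)⁻¹]
  refine mul_le_mul_of_nonneg_right ((mul_le_of_le_one_left (mul_nonneg (h0 _) (h0 _))
    (prod_one_sub_le_one hq0 hq1 _)).trans ?_) (by positivity)
  exact mul_le_mul (invQFactorial_le hq0 hq1 _) (invQFactorial_le hq0 hq1 _) (h0 _)
    ((h0 0).trans (invQFactorial_le hq0 hq1 _))

/-- **Jacobi triple product identity.** -/
theorem theta_eq_qPoch {x : ℝ} (hx0 : 0 < x) (hx1 : x < 1) {w : ℝ} (hw : w ≠ 0) :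
    theta x w = qPoch (x ^ 2) (x ^ 2) * qPoch (-(w * x)) (x ^ 2) * qPoch (-(w⁻¹ * x)) (x ^ 2) := by
  have hq0 : 0 < x ^ 2 := by positivity
  have hq1 : x ^ 2 < 1 := pow_lt_one₀ hx0.le hx1 two_ne_zero
  have hP := qPoch_ne_zero hq1 hq0 hq1
  have hsum : Summable fun j : ℤ ↦ (qPoch (x ^ 2) (x ^ 2))⁻¹ ^ 2 * (|w| ^ j * x ^ (j ^ 2)) :=
    (summable_theta hx0 hx1 (abs_ne_zero.mpr hw)).mul_left _
  have hlim := tendsto_tsum_of_dominated_convergence hsum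
    (fun j ↦ (tendsto_tripleCoeff hx0 hx1 j).mul_const (w ^ j)) (Eventually.of_forall fun n j ↦ by
      rw [norm_mul, norm_zpow, Real.norm_eq_abs w, mul_left_comm, mul_comm]
      gcongr
      exact norm_tripleCoeff_le hx0 hx1 n j)
  simp only [(hasSum_tripleCoeff hx0 hx1 hw _).tsum_eq, mul_assoc, tsum_mul_left] at hlim
  have hlim' := (tendsto_qPoch (-(w * x)) hq0 hq1).mul (tendsto_qPoch (-(w⁻¹ * x)) hq0 hq1)
  simp only [← prod_mul_distrib] at hlim'
  have key := tendsto_nhds_unique (hlim'.congr fun N ↦ prod_congr rfl fun k _ ↦ by ring) hlim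
  rw [mul_assoc, key, mul_inv_cancel_left₀ hP, theta]
  simp only [mul_comm]

end TripleProduct

section Theta

lemma theta_inv (x w : ℝ) : theta x w⁻¹ = theta x w := by
  rw [theta, theta, ← (Equiv.neg ℤ).tsum_eq]
  simp

lemma theta_eq_mul_theta_mul_sq {x : ℝ} (hx : x ≠ 0) {w : ℝ} (hw : w ≠ 0) :
    theta x w = w * x * theta x (w * x ^ 2) := by
  rw [theta, theta, ← (Equiv.addRight (1 : ℤ)).tsum_eq, ← tsum_mul_left]
  refine tsum_congr fun n ↦ ?_
  have h : (x ^ 2) ^ n = x ^ (2 * n) := by rw [zpow_mul]; norm_cast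
  rw [Equiv.coe_addRight, mul_zpow, h, zpow_add_one₀ hw,
    show (n + 1) ^ 2 = n ^ 2 + 2 * n + 1 by ring, zpow_add_one₀ hx, zpow_add₀ hx]
  ring

lemma theta_neg_inv_eq_zero {x : ℝ} (hx : x ≠ 0) : theta x (-x⁻¹) = 0 := by
  have h := theta_eq_mul_theta_mul_sq hx (neg_ne_zero.mpr (inv_ne_zero hx))
  rw [show -x⁻¹ * x ^ 2 = (-x⁻¹)⁻¹ by field_simp, theta_inv, neg_mul, inv_mul_cancel₀ hx] at h
  linarith

/-- Euler's pentagonal number theorem. -/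
lemma theta_pow_three_neg {x : ℝ} (hx0 : 0 < x) (hx1 : x < 1) :
    theta (x ^ 3) (-x) = qPoch (x ^ 2) (x ^ 2) := by
  have hx := hx0.ne'
  rw [theta_eq_qPoch (by positivity) (pow_lt_one₀ hx0.le hx1 three_ne_zero) (neg_ne_zero.mpr hx),
    qPoch_split (x ^ 2) (y := x ^ 2) (by positivity) (pow_lt_one₀ hx0.le hx1 two_ne_zero)
      (k := 3) (by norm_num)]
  simp only [prod_range_succ, prod_range_zero]
  rw [show -((-x)⁻¹ * x ^ 3) = x ^ 2 by field_simp]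
  ring_nf

lemma tsum_int_eq_sum_range {f : ℤ → ℝ} (hf : Summable f) {k : ℕ} (hk : 0 < k) :
    ∑' n : ℤ, f n = ∑ r ∈ range k, ∑' m : ℤ, f (m * k + r) := by
  have : NeZero k := ⟨hk.ne'⟩
  have hf' : Summable fun p : Fin k × ℤ ↦ f (p.2 * k + (p.1 : ℕ)) :=
    ((Equiv.prodComm _ _).trans (Int.divModEquiv k).symm).summable_iff.mpr hf
  rw [← ((Equiv.prodComm _ _).trans (Int.divModEquiv k).symm).tsum_eq, ← Fin.sum_univ_eq_sum_range
    (fun r ↦ ∑' m : ℤ, f (m * k + r))]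
  exact hf'.tsum_prod.trans (tsum_fintype _)

lemma theta_dissection {x : ℝ} (hx0 : 0 < x) (hx1 : x < 1) {w : ℝ} (hw : w ≠ 0)
    {k : ℕ} (hk : 0 < k) :
    theta x w = ∑ r ∈ range k, w ^ r * x ^ (r ^ 2) *
      theta (x ^ (k ^ 2)) (w ^ k * x ^ (2 * k * r)) := by
  have hx := hx0.ne'
  rw [theta, tsum_int_eq_sum_range (summable_theta hx0 hx1 hw) hk]
  refine sum_congr rfl fun r _ ↦ ?_
  rw [theta, ← tsum_mul_left]
  refine tsum_congr fun m ↦ ?_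
  rw [mul_zpow, ← zpow_natCast w r, ← zpow_natCast w k, ← zpow_natCast x (r ^ 2),
    ← zpow_natCast x (k ^ 2), ← zpow_natCast x (2 * k * r), ← zpow_mul, ← zpow_mul, ← zpow_mul,
    show (m * k + r) ^ 2 = ((r ^ 2 : ℕ) : ℤ) + ((2 * k * r : ℕ) : ℤ) * m +
      ((k ^ 2 : ℕ) : ℤ) * m ^ 2 by push_cast; ring,
    zpow_add₀ hw, zpow_add₀ hx, zpow_add₀ hx, mul_comm m (k : ℤ)]
  ring

/-- The substitution `(N, n) ↦ (N - 2 n, n)`. -/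
def shearEquiv : ℤ × ℤ ≃ ℤ × ℤ where
  toFun p := (p.1 - 2 * p.2, p.2)
  invFun p := (p.1 + 2 * p.2, p.2)
  left_inv p := by simp
  right_inv p := by simp

lemma theta_mul_theta {x : ℝ} (hx0 : 0 < x) (hx1 : x < 1) {w : ℝ} (hw : w ≠ 0) :
    theta x w * theta (x ^ 2) (-(x ^ 2 * w ^ 2)) =
      ∑ r ∈ range 3, w ^ r * x ^ (r ^ 2) * theta (x ^ 3) (-(w ^ 3 * x ^ (2 * r + 2))) *
        theta (x ^ 6) (-(x ^ 2 * (x ^ (4 * r))⁻¹)) := by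
  have hx := hx0.ne'
  have hv : -(x ^ 2 * w ^ 2) ≠ 0 := neg_ne_zero.mpr (by positivity)
  have h1 := (summable_theta hx0 hx1 hw).norm
  have h2 := (summable_theta (by positivity) (pow_lt_one₀ hx0.le hx1 two_ne_zero) hv).norm
  have h3 := shearEquiv.summable_iff.mpr (summable_mul_of_summable_norm h1 h2)
  rw [theta, theta, tsum_mul_tsum_of_summable_norm h1 h2, ← shearEquiv.tsum_eq]
  refine h3.tsum_prod.trans ?_
  rw [tsum_int_eq_sum_range h3.prod (k := 3) (by norm_num)]
  refine sum_congr rfl fun r _ ↦ ?_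
  rw [theta, theta, mul_assoc, ← tsum_mul_right, ← tsum_mul_left]
  refine tsum_congr fun k ↦ ?_
  rw [← (Equiv.addRight k).tsum_eq, ← tsum_mul_left, ← tsum_mul_left]
  refine tsum_congr fun j ↦ ?_
  have e (a : ℕ) (b : ℤ) : (x ^ a) ^ b = x ^ (a * b) := by rw [zpow_mul, zpow_natCast]
  have e' (a : ℕ) (b : ℤ) : (w ^ a) ^ b = w ^ (a * b) := by rw [zpow_mul, zpow_natCast]
  have en (u v : ℝ) (b : ℤ) : (-(u * v)) ^ b = (-1) ^ b * (u ^ b * v ^ b) := by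
    rw [← mul_zpow, ← mul_zpow, neg_one_mul]
  simp only [shearEquiv, Function.comp_apply, Equiv.coe_fn_mk, Equiv.coe_addRight, en,
    inv_zpow, e, e', ← zpow_neg]
  rw [← zpow_natCast x (r ^ 2), ← zpow_natCast w r]
  have c1 : w ^ (k * (3 : ℕ) + r - 2 * (j + k)) * w ^ ((2 : ℕ) * (j + k)) =
      w ^ (r : ℤ) * w ^ ((3 : ℕ) * k) := by
    rw [← zpow_add₀ hw, ← zpow_add₀ hw]
    congr 1
    push_cast
    ring
  have c2 : x ^ ((k * (3 : ℕ) + r - 2 * (j + k)) ^ 2) * x ^ ((2 : ℕ) * (j + k)) *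
      x ^ ((2 : ℕ) * (j + k) ^ 2) = x ^ ((r ^ 2 : ℕ) : ℤ) * x ^ ((2 * r + 2 : ℕ) * k) *
        x ^ ((3 : ℕ) * k ^ 2) * x ^ ((2 : ℕ) * j) * x ^ (-((4 * r : ℕ) * j)) *
        x ^ ((6 : ℕ) * j ^ 2) := by
    simp only [← zpow_add₀ hx]
    congr 1
    push_cast
    ring
  rw [zpow_add₀ (by norm_num : (-1 : ℝ) ≠ 0)]
  linear_combination (-1) ^ j * (-1) ^ k * (w ^ (r : ℤ) * w ^ ((3 : ℕ) * k)) * c2 +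
    (-1) ^ j * (-1) ^ k * (x ^ ((k * (3 : ℕ) + r - 2 * (j + k)) ^ 2) * x ^ ((2 : ℕ) * (j + k)) *
      x ^ ((2 : ℕ) * (j + k) ^ 2)) * c1

/-- **Quintuple product identity**, in terms of theta series. -/
theorem quintuple_product {x : ℝ} (hx0 : 0 < x) (hx1 : x < 1) {w : ℝ} (hw : w ≠ 0) :
    theta x w * theta (x ^ 2) (-(x ^ 2 * w ^ 2)) = qPoch (x ^ 4) (x ^ 4) *
      (theta (x ^ 3) (-(w ^ 3 * x ^ 2)) + w * x * theta (x ^ 3) (-(w ^ 3 * x ^ 4))) := by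
  have hx := hx0.ne'
  have h0 : theta (x ^ 6) (-x ^ 2) = qPoch (x ^ 4) (x ^ 4) := by
    have := theta_pow_three_neg (x := x ^ 2) (by positivity) (pow_lt_one₀ hx0.le hx1 two_ne_zero)
    ring_nf at this ⊢
    exact this
  have h1 : theta (x ^ 6) (-(x ^ 2 * (x ^ 4)⁻¹)) = qPoch (x ^ 4) (x ^ 4) := by
    rw [← h0, ← theta_inv _ (-x ^ 2)]
    congr 1
    field_simp
  have h2 : theta (x ^ 6) (-(x ^ 2 * (x ^ 8)⁻¹)) = 0 := by
    rw [← theta_neg_inv_eq_zero (pow_ne_zero 6 hx)]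
    congr 1
    field_simp
  rw [theta_mul_theta hx0 hx1 hw]
  simp only [sum_range_succ, sum_range_zero, Nat.reduceMul, Nat.reduceAdd,
    pow_zero, inv_one, mul_one, h0, h1, h2]
  ring

end Theta

section FiveDissection

variable {x : ℝ}

lemma theta_five_dissection (hx0 : 0 < x) (hx1 : x < 1) :
    qPoch (x ^ 2) (x ^ 2) =
      (theta (x ^ 75) (-x ^ 5) + x ^ 10 * theta (x ^ 75) (-x ^ 55)) -
        x ^ 2 * qPoch (x ^ 50) (x ^ 50) -
        x ^ 4 * (theta (x ^ 75) (-x ^ 35) - x ^ 10 * theta (x ^ 75) (-x ^ 65)) := by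
  have hx := hx0.ne'
  have h25 := theta_pow_three_neg (x := x ^ 25) (by positivity)
    (pow_lt_one₀ hx0.le hx1 (by norm_num))
  have h3 : theta (x ^ 75) (-x ^ 55) = -x ^ 20 * theta (x ^ 75) (-x ^ 95) := by
    rw [← theta_inv, theta_eq_mul_theta_mul_sq (by positivity) (by simp [hx])]
    congr 1
    · field_simp
    · congr 1
      field_simp
  have h4 : theta (x ^ 75) (-x ^ 25) = -x ^ 50 * theta (x ^ 75) (-x ^ 125) := by
    rw [← theta_inv, theta_eq_mul_theta_mul_sq (by positivity) (by simp [hx])]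
    congr 1
    · field_simp
    · congr 1
      field_simp
  have h := theta_dissection (x := x ^ 3) (by positivity) (pow_lt_one₀ hx0.le hx1 three_ne_zero)
    (neg_ne_zero.mpr hx) (k := 5) (by norm_num)
  rw [theta_pow_three_neg hx0 hx1] at h
  simp only [sum_range_succ, sum_range_zero] at h
  rw [h3, show x ^ 50 = (x ^ 25) ^ 2 by ring, ← h25, show (x ^ 25) ^ 3 = x ^ 75 by ring, h4, h]
  ring_nf

lemma qPoch_mul_even_odd (c : ℝ) (hx0 : 0 < x) (hx1 : x < 1) :
    qPoch (c * x ^ 50) (x ^ 100) * qPoch c (x ^ 100) = qPoch c (x ^ 50) := by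
  rw [qPoch_split c (y := x ^ 50) (by positivity) (pow_lt_one₀ hx0.le hx1 (by norm_num))
    (k := 2) (by norm_num)]
  simp only [prod_range_succ, prod_range_zero]
  ring_nf

lemma theta_sum_mul_qPoch (hx0 : 0 < x) (hx1 : x < 1) :
    (theta (x ^ 75) (-x ^ 5) + x ^ 10 * theta (x ^ 75) (-x ^ 55)) *
      (qPoch (x ^ 10) (x ^ 50) * qPoch (x ^ 40) (x ^ 50)) =
      qPoch (x ^ 50) (x ^ 50) * (qPoch (x ^ 20) (x ^ 50) * qPoch (x ^ 30) (x ^ 50)) := by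
  have hx := hx0.ne'
  have lt1 {n : ℕ} (hn : n ≠ 0) : x ^ n < 1 := pow_lt_one₀ hx0.le hx1 hn
  have hQ := quintuple_product (x := x ^ 25) (by positivity) (lt1 (by norm_num))
    (w := (x ^ 15)⁻¹) (by positivity)
  rw [show -((x ^ 25) ^ 2 * (x ^ 15)⁻¹ ^ 2) = -x ^ 20 by field_simp,
    show -((x ^ 15)⁻¹ ^ 3 * (x ^ 25) ^ 2) = -x ^ 5 by field_simp,
    show -((x ^ 15)⁻¹ ^ 3 * (x ^ 25) ^ 4) = -x ^ 55 by field_simp,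
    show (x ^ 15)⁻¹ * x ^ 25 = x ^ 10 by field_simp, theta_inv, ← pow_mul, ← pow_mul, ← pow_mul,
    theta_eq_qPoch (by positivity) (lt1 (by norm_num)) (by positivity),
    theta_eq_qPoch (by positivity) (lt1 (by norm_num)) (by simp [hx]),
    show -((x ^ 15)⁻¹ * x ^ 25) = -x ^ 10 by field_simp,
    show -((-x ^ 20)⁻¹ * x ^ (25 * 2)) = x ^ 30 by field_simp] at hQ
  simp only [neg_mul, neg_neg, ← pow_mul, ← pow_add, Nat.reduceMul, Nat.reduceAdd] at hQ
  have hP := qPoch_ne_zero (c := x ^ 100) (lt1 (by norm_num)) (y := x ^ 100) (by positivity)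
    (lt1 (by norm_num))
  have s1 := qPoch_sq (x ^ 10) (y := x ^ 50) (by positivity) (lt1 (by norm_num))
  have s4 := qPoch_sq (x ^ 40) (y := x ^ 50) (by positivity) (lt1 (by norm_num))
  have m2 := qPoch_mul_even_odd (x ^ 20) hx0 hx1
  have m3 := qPoch_mul_even_odd (x ^ 30) hx0 hx1
  simp only [← pow_mul, ← pow_add, Nat.reduceMul, Nat.reduceAdd] at s1 s4 m2 m3
  rw [← m2, ← m3, s1, s4]
  apply mul_left_cancel₀ hP
  linear_combination -(qPoch (x ^ 10) (x ^ 50) * qPoch (x ^ 40) (x ^ 50)) * hQ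

lemma theta_sub_mul_qPoch (hx0 : 0 < x) (hx1 : x < 1) :
    (theta (x ^ 75) (-x ^ 35) - x ^ 10 * theta (x ^ 75) (-x ^ 65)) *
      (qPoch (x ^ 20) (x ^ 50) * qPoch (x ^ 30) (x ^ 50)) =
      qPoch (x ^ 50) (x ^ 50) * (qPoch (x ^ 10) (x ^ 50) * qPoch (x ^ 40) (x ^ 50)) := by
  have hx := hx0.ne'
  have lt1 {n : ℕ} (hn : n ≠ 0) : x ^ n < 1 := pow_lt_one₀ hx0.le hx1 hn
  have h65 : theta (x ^ 75) (-x ^ 65) = -x ^ 10 * theta (x ^ 75) (-x ^ 85) := by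
    rw [← theta_inv, theta_eq_mul_theta_mul_sq (by positivity) (by simp [hx])]
    congr 1
    · field_simp
    · congr 1
      field_simp
  have hQ := quintuple_product (x := x ^ 25) (by positivity) (lt1 (by norm_num))
    (w := (x ^ 5)⁻¹) (by positivity)
  rw [show -((x ^ 25) ^ 2 * (x ^ 5)⁻¹ ^ 2) = -x ^ 40 by field_simp,
    show -((x ^ 5)⁻¹ ^ 3 * (x ^ 25) ^ 2) = -x ^ 35 by field_simp,
    show -((x ^ 5)⁻¹ ^ 3 * (x ^ 25) ^ 4) = -x ^ 85 by field_simp,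
    show (x ^ 5)⁻¹ * x ^ 25 = x ^ 20 by field_simp, theta_inv, ← pow_mul, ← pow_mul, ← pow_mul,
    theta_eq_qPoch (by positivity) (lt1 (by norm_num)) (by positivity),
    theta_eq_qPoch (by positivity) (lt1 (by norm_num)) (by simp [hx]),
    show -((x ^ 5)⁻¹ * x ^ 25) = -x ^ 20 by field_simp,
    show -((-x ^ 40)⁻¹ * x ^ (25 * 2)) = x ^ 10 by field_simp] at hQ
  simp only [neg_mul, neg_neg, ← pow_mul, ← pow_add, Nat.reduceMul, Nat.reduceAdd] at hQ
  have hP := qPoch_ne_zero (c := x ^ 100) (lt1 (by norm_num)) (y := x ^ 100) (by positivity)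
    (lt1 (by norm_num))
  have s2 := qPoch_sq (x ^ 20) (y := x ^ 50) (by positivity) (lt1 (by norm_num))
  have s3 := qPoch_sq (x ^ 30) (y := x ^ 50) (by positivity) (lt1 (by norm_num))
  have m1 := qPoch_mul_even_odd (x ^ 10) hx0 hx1
  have m4 := qPoch_mul_even_odd (x ^ 40) hx0 hx1
  simp only [← pow_mul, ← pow_add, Nat.reduceMul, Nat.reduceAdd] at s2 s3 m1 m4
  rw [← m1, ← m4, s2, s3, h65]
  apply mul_left_cancel₀ hP
  linear_combination -(qPoch (x ^ 20) (x ^ 50) * qPoch (x ^ 30) (x ^ 50)) * hQ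

end FiveDissection

section ContinuedFraction

lemma multipliable_chi5 {q : ℝ} (hq0 : 0 < q) (hq1 : q < 1) :
    Multipliable fun n : ℕ ↦ (1 - q ^ (n + 1)) ^ chi5 (n + 1) := by
  have hs : Summable fun n : ℕ ↦ ‖(1 - q ^ (n + 1)) ^ chi5 (n + 1) - 1‖ := by
    refine Summable.of_nonneg_of_le (fun _ ↦ norm_nonneg _) (fun n ↦ ?_)
      ((summable_geometric_of_lt_one hq0.le hq1).mul_left (1 - q)⁻¹)
    have hq : 0 < 1 - q := by linarith
    have h0 : 0 < q ^ n := by positivity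
    have h1 : q ^ (n + 1) ≤ q := pow_le_of_le_one hq0.le hq1.le (by simp)
    have h2 : q ^ (n + 1) ≤ q ^ n := pow_le_pow_of_le_one hq0.le hq1.le (by simp)
    have h3 : 0 < q ^ (n + 1) := by positivity
    have h4 : 1 ≤ (1 - q)⁻¹ := (one_le_inv₀ hq).mpr (by linarith)
    unfold chi5
    split_ifs
    · rw [zpow_one, sub_sub_cancel_left, norm_neg, Real.norm_of_nonneg h3.le]
      nlinarith
    · have h5 : (1 - q ^ (n + 1))⁻¹ - 1 = (1 - q ^ (n + 1))⁻¹ * q ^ (n + 1) := by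
        have : 1 - q ^ (n + 1) ≠ 0 := by linarith
        field_simp
        ring
      have h6 : (1 - q ^ (n + 1))⁻¹ ≤ (1 - q)⁻¹ := inv_anti₀ hq (by linarith)
      rw [zpow_neg_one, h5, Real.norm_of_nonneg (mul_nonneg (inv_nonneg.mpr (by linarith)) h3.le)]
      gcongr
    · simp only [zpow_zero, sub_self, norm_zero]
      positivity
  simpa only [add_sub_cancel] using multipliable_one_add_of_summable hs

lemma tprod_chi5 {q : ℝ} (hq0 : 0 < q) (hq1 : q < 1) :
    ∏' n : ℕ, (1 - q ^ (n + 1)) ^ chi5 (n + 1) =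
      (qPoch q (q ^ 5) * qPoch (q ^ 4) (q ^ 5)) /
        (qPoch (q ^ 2) (q ^ 5) * qPoch (q ^ 3) (q ^ 5)) := by
  have h5 : 0 < q ^ 5 := by positivity
  have lt1 {n : ℕ} (hn : n ≠ 0) : q ^ n < 1 := pow_lt_one₀ hq0.le hq1 hn
  have h51 : q ^ 5 < 1 := lt1 (by norm_num)
  have hlim := ((tendsto_qPoch q h5 h51).mul (tendsto_qPoch (q ^ 4) h5 h51)).div
    ((tendsto_qPoch (q ^ 2) h5 h51).mul (tendsto_qPoch (q ^ 3) h5 h51))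
    (mul_ne_zero (qPoch_ne_zero (lt1 (by norm_num)) h5 h51)
      (qPoch_ne_zero (lt1 (by norm_num)) h5 h51))
  refine tendsto_nhds_unique (tendsto_prod_blocks (k := 5) (by norm_num)
    (multipliable_chi5 hq0 hq1).tendsto_prod_tprod_nat) (hlim.congr fun N ↦ ?_)
  simp only [Pi.div_apply, ← prod_mul_distrib, ← prod_div_distrib]
  refine prod_congr rfl fun i _ ↦ ?_
  have c1 : chi5 (5 * i + 0 + 1) = 1 := by simp [chi5, Nat.add_mod]
  have c2 : chi5 (5 * i + 1 + 1) = -1 := by simp [chi5, Nat.add_mod]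
  have c3 : chi5 (5 * i + 2 + 1) = -1 := by simp [chi5, Nat.add_mod]
  have c4 : chi5 (5 * i + 3 + 1) = 1 := by simp [chi5, Nat.add_mod]
  have c5 : chi5 (5 * i + 4 + 1) = 0 := by simp [chi5, Nat.add_mod]
  simp only [prod_range_succ, prod_range_zero, c1, c2, c3, c4, c5, zpow_one, zpow_neg_one,
    zpow_zero, div_eq_mul_inv, mul_inv]
  ring

lemma ramanujanF_eq_qPoch (q : ℝ) : ramanujanF q = qPoch q q := by
  simp only [ramanujanF, qPoch, pow_succ']

end ContinuedFraction

end RogersRamanujan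

open RogersRamanujan

theorem rogersRamanujan_degree_five_modular_relation
    (q : ℝ) (hq0 : 0 < q) (hq1 : q < 1) :
    1 / RR q - 1 - RR q =
      (∏' n : ℕ, (1 - q ^ (((n : ℝ) + 1) / 5))) /
        (q ^ ((1 : ℝ) / 5) * ramanujanF (q ^ 5)) := by
  obtain ⟨x, hx0, hx1, rfl⟩ : ∃ x : ℝ, 0 < x ∧ x < 1 ∧ q = x ^ 10 :=
    ⟨q ^ ((1 : ℝ) / 10), by positivity, Real.rpow_lt_one hq0.le hq1 (by norm_num), by
      rw [← Real.rpow_natCast, ← Real.rpow_mul hq0.le]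
      norm_num⟩
  have hroot (n : ℕ) : (x ^ 10) ^ (((n : ℝ) + 1) / 5) = x ^ 2 * (x ^ 2) ^ n := by
    rw [← Real.rpow_natCast x 10, ← Real.rpow_mul hx0.le, ← pow_succ', ← pow_mul,
      ← Real.rpow_natCast x (2 * (n + 1))]
    congr 1
    push_cast
    ring
  have hroot0 : (x ^ 10) ^ ((1 : ℝ) / 5) = x ^ 2 := by simpa using hroot 0
  have hprod : ∏' n : ℕ, (1 - (x ^ 10) ^ (((n : ℝ) + 1) / 5)) = qPoch (x ^ 2) (x ^ 2) := by
    simp only [hroot, qPoch]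
  have hne {n : ℕ} (hn : n ≠ 0) : qPoch (x ^ n) (x ^ 50) ≠ 0 :=
    qPoch_ne_zero (pow_lt_one₀ hx0.le hx1 hn) (by positivity)
      (pow_lt_one₀ hx0.le hx1 (by norm_num))
  have h1 := hne (n := 10) (by norm_num)
  have h2 := hne (n := 20) (by norm_num)
  have h3 := hne (n := 30) (by norm_num)
  have h4 := hne (n := 40) (by norm_num)
  have h5 := hne (n := 50) (by norm_num)
  have hJ₁ := theta_sum_mul_qPoch hx0 hx1
  have hJ₂ := theta_sub_mul_qPoch hx0 hx1
  rw [← eq_div_iff (mul_ne_zero h1 h4)] at hJ₁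
  rw [← eq_div_iff (mul_ne_zero h2 h3)] at hJ₂
  rw [hprod, RR, hroot0, tprod_chi5 hq0 hq1, ramanujanF_eq_qPoch, theta_five_dissection hx0 hx1,
    hJ₁, hJ₂]
  simp only [← pow_mul, Nat.reduceMul]
  field_simp
end

section
/- The Rogers–Ramanujan continued fraction satisfies R(e^{−2π}) = −1/2 − √5/2 + √((5 + √5)/2), where R(q) = q^{1/5} ∏_{n=1}^∞ (1 − qⁿ)^{χ₅(n)}. -/
open Real

open Finset Filter Topology

section JacobiTripleProduct

lemma exists_tendsto_prod_one_sub {g : ℕ → ℝ} (hg : Summable g) (h0 : ∀ k, 0 ≤ g k)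
    (h1 : ∀ k, g k < 1) :
    ∃ L : ℝ, 0 < L ∧ Tendsto (fun N => ∏ k ∈ range N, (1 - g k)) atTop (𝓝 L) := by
  have hs : Summable fun k => ‖-g k‖ := by simpa [abs_of_nonneg (h0 _)] using hg
  have hne : ∏' k, (1 + -g k) ≠ 0 :=
    tprod_one_add_ne_zero_of_summable (fun k => by linarith [h1 k]) hs
  have ht := (multipliable_one_add_of_summable hs).tendsto_prod_tprod_nat
  simp only [← sub_eq_add_neg] at ht hne
  refine ⟨_, lt_of_le_of_ne (ge_of_tendsto' ht fun N => ?_) hne.symm, ht⟩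
  exact prod_nonneg fun k _ => by linarith [h1 k]

/-- The reciprocal of the finite product `(1 - p) (1 - p ^ 2) ⋯ (1 - p ^ m)`,
extended by zero to negative `m`. -/
noncomputable def invPoch (p : ℝ) (m : ℤ) : ℝ :=
  if 0 ≤ m then (∏ k ∈ range m.toNat, (1 - p ^ (k + 1)))⁻¹ else 0

variable {p r y : ℝ}

lemma one_sub_pow_pos (h0 : 0 < p) (h1 : p < 1) (k : ℕ) : 0 < 1 - p ^ (k + 1) :=
  sub_pos.2 (pow_lt_one₀ h0.le h1 k.succ_ne_zero)

lemma invPoch_natCast (n : ℕ) :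
    invPoch p n = (∏ k ∈ range n, (1 - p ^ (k + 1)))⁻¹ := by
  simp [invPoch]

lemma invPoch_of_neg {m : ℤ} (hm : m < 0) : invPoch p m = 0 := by
  simp [invPoch, hm]

lemma invPoch_sub_one (h0 : 0 < p) (h1 : p < 1) (m : ℤ) :
    invPoch p (m - 1) = (1 - p ^ m) * invPoch p m := by
  rcases lt_trichotomy m 0 with hm | rfl | hm
  · rw [invPoch_of_neg hm, invPoch_of_neg (by lia), mul_zero]
  · rw [invPoch_of_neg (by lia)]; simp
  · obtain ⟨n, rfl⟩ : ∃ n : ℕ, m = ((n + 1 : ℕ) : ℤ) := ⟨(m - 1).toNat, by lia⟩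
    have e : ((n + 1 : ℕ) : ℤ) - 1 = (n : ℕ) := by push_cast; ring
    have := (one_sub_pow_pos h0 h1 n).ne'
    rw [e, invPoch_natCast, invPoch_natCast, prod_range_succ, mul_inv, zpow_natCast]
    field_simp

lemma invPoch_nonneg (h0 : 0 < p) (h1 : p < 1) (m : ℤ) : 0 ≤ invPoch p m := by
  rw [invPoch]
  split_ifs
  · exact inv_nonneg.2 (prod_nonneg fun k _ => (one_sub_pow_pos h0 h1 k).le)
  · exact le_rfl

/-- The coefficients of the finite form of the Jacobi triple product. -/
noncomputable def tripleCoeff (p : ℝ) (N : ℕ) (j : ℤ) : ℝ :=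
  (∏ k ∈ range (2 * N), (1 - p ^ (k + 1))) * (invPoch p (N + j) * invPoch p (N - j))

lemma tripleCoeff_succ (h0 : 0 < p) (h1 : p < 1) (N : ℕ) (j : ℤ) :
    tripleCoeff p (N + 1) j = (1 + p ^ (2 * N + 1)) * tripleCoeff p N j
      + p ^ ((N : ℤ) + 1 - j) * tripleCoeff p N (j - 1)
      + p ^ ((N : ℤ) + 1 + j) * tripleCoeff p N (j + 1) := by
  have hp := h0.ne'
  have hX1 := invPoch_sub_one h0 h1 (N + 1 + j)
  have hX2 := invPoch_sub_one h0 h1 (N + 1 + j - 1)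
  have hY1 := invPoch_sub_one h0 h1 (N + 1 - j)
  have hY2 := invPoch_sub_one h0 h1 (N + 1 - j - 1)
  have huv : p ^ ((N : ℤ) + 1 + j) * p ^ ((N : ℤ) + 1 - j) = p ^ (2 * N + 2) := by
    rw [← zpow_add₀ hp, ← zpow_natCast]; congr 1; push_cast; ring
  rw [zpow_sub_one₀ hp] at hX2 hY2
  simp only [tripleCoeff]
  rw [show 2 * (N + 1) = 2 * N + 1 + 1 by ring, prod_range_succ, prod_range_succ]
  push_cast
  rw [show (N : ℤ) + j = N + 1 + j - 1 by ring, show (N : ℤ) - j = N + 1 - j - 1 by ring,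
    show (N : ℤ) + (j - 1) = N + 1 + j - 1 - 1 by ring,
    show (N : ℤ) - (j - 1) = N + 1 - j by ring,
    show (N : ℤ) + (j + 1) = N + 1 + j by ring,
    show (N : ℤ) - (j + 1) = N + 1 - j - 1 - 1 by ring, hX2, hY2, hX1, hY1]
  have hv : p ^ (2 * N + 1) = p ^ ((N : ℤ) + 1 + j) * p ^ ((N : ℤ) + 1 - j) * p⁻¹ := by
    rw [huv, pow_succ p (2 * N + 1)]; field_simp
  rw [show 2 * N + 1 + 1 = 2 * N + 2 by ring, ← huv, hv]
  ring

lemma hasSum_tripleCoeff (hr0 : 0 < r) (hr1 : r < 1) (hy : y ≠ 0) (N : ℕ) :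
    HasSum (fun j : ℤ => r ^ (j * (j - 1)) * (-y) ^ j * tripleCoeff (r ^ 2) N j)
      (∏ k ∈ range N, (1 - y * r ^ (2 * k)) * (1 - y⁻¹ * r ^ (2 * k + 2))) := by
  have h0 : 0 < r ^ 2 := by positivity
  have h1 : r ^ 2 < 1 := by nlinarith
  have hr := hr0.ne'
  have hy' : -y ≠ 0 := neg_ne_zero.2 hy
  induction N with
  | zero =>
    convert hasSum_single (0 : ℤ) ?_ using 1
    · simp [tripleCoeff, invPoch]
    · intro j hj
      rcases lt_or_gt_of_ne hj with h | h
      · simp [tripleCoeff, invPoch_of_neg (p := r ^ 2) h]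
      · simp [tripleCoeff, invPoch_of_neg (p := r ^ 2) (show -j < 0 by lia)]
  | succ N ih =>
    have hm := ((Equiv.subRight (1 : ℤ)).hasSum_iff.2 ih).mul_left (-y * r ^ (2 * N))
    have hp := ((Equiv.addRight (1 : ℤ)).hasSum_iff.2 ih).mul_left (-y⁻¹ * r ^ (2 * N + 2))
    refine (congrArg₂ (HasSum · ·) (funext fun j => ?_) ?_).mpr
      (((ih.mul_left (1 + r ^ (2 * (2 * N + 1)))).add hm).add hp)
    · simp only [Function.comp, Equiv.subRight_apply, Equiv.coe_addRight]
      rw [tripleCoeff_succ h0 h1]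
      have e1 : r ^ ((j - 1) * (j - 1 - 1)) = r ^ (j * (j - 1)) * (r ^ (2 * j - 2))⁻¹ := by
        rw [← zpow_neg, ← zpow_add₀ hr]; congr 1; ring
      have e2 : r ^ ((j + 1) * (j + 1 - 1)) = r ^ (j * (j - 1)) * r ^ (2 * j) := by
        rw [← zpow_add₀ hr]; congr 1; ring
      have e3 : (r ^ 2) ^ ((N : ℤ) + 1 - j) = r ^ (2 * N) * (r ^ (2 * j - 2))⁻¹ := by
        rw [← zpow_natCast, ← zpow_natCast, ← zpow_mul, ← zpow_neg, ← zpow_add₀ hr]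
        congr 1; push_cast; ring
      have e4 : (r ^ 2) ^ ((N : ℤ) + 1 + j) = r ^ (2 * N + 2) * r ^ (2 * j) := by
        rw [← zpow_natCast, ← zpow_natCast, ← zpow_mul, ← zpow_add₀ hr]
        congr 1; push_cast; ring
      rw [e1, e2, e3, e4, zpow_sub_one₀ hy', zpow_add_one₀ hy', ← pow_mul]
      field_simp
    · rw [prod_range_succ]
      field_simp
      ring

lemma summable_theta (hr0 : 0 < r) (hr1 : r < 1) (hy : y ≠ 0) :
    Summable fun j : ℤ => r ^ (j * (j - 1)) * (-y) ^ j := by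
  have hlr : 0 < -log r := neg_pos.2 (log_neg hr0 hr1)
  set τ : ℂ := ((-log r / π : ℝ) : ℂ) * Complex.I with hτ
  set z : ℂ := ((-(log |y| - log r) / (2 * π) : ℝ) : ℂ) * Complex.I with hz
  have him : 0 < τ.im := by
    rw [hτ, Complex.im_ofReal_mul, Complex.I_im, mul_one]
    exact div_pos hlr pi_pos
  refine Summable.of_norm (((summable_jacobiTheta₂_term_iff z τ).2 him).norm.congr fun j => ?_)
  rw [norm_jacobiTheta₂_term, hτ, hz, Complex.im_ofReal_mul, Complex.im_ofReal_mul, Complex.I_im,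
    norm_mul, norm_zpow, norm_zpow, norm_neg, Real.norm_eq_abs, Real.norm_eq_abs, abs_of_pos hr0,
    ← Real.rpow_intCast, ← Real.rpow_intCast, Real.rpow_def_of_pos hr0,
    Real.rpow_def_of_pos (abs_pos.2 hy), ← Real.exp_add]
  congr 1
  push_cast
  field_simp
  ring

/-- The Jacobi triple product identity, with the product side as a limit of partial products. -/
theorem tendsto_jacobi_triple_product (hr0 : 0 < r) (hr1 : r < 1) (hy : y ≠ 0) :
    Tendsto (fun N => (∏ k ∈ range N, (1 - (r ^ 2) ^ (k + 1))) *
      ∏ k ∈ range N, (1 - y * r ^ (2 * k)) * (1 - y⁻¹ * r ^ (2 * k + 2))) atTop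
      (𝓝 (∑' j : ℤ, r ^ (j * (j - 1)) * (-y) ^ j)) := by
  have h0 : 0 < r ^ 2 := by positivity
  have h1 : r ^ 2 < 1 := by nlinarith
  set P : ℕ → ℝ := fun N => ∏ k ∈ range N, (1 - (r ^ 2) ^ (k + 1))
  obtain ⟨L, hL, hPL⟩ : ∃ L : ℝ, 0 < L ∧ Tendsto P atTop (𝓝 L) :=
    exists_tendsto_prod_one_sub
      ((summable_nat_add_iff 1).2 (summable_geometric_of_lt_one h0.le h1))
      (fun k => by positivity) fun k => sub_pos.1 (one_sub_pow_pos h0 h1 k)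
  have hP0 : ∀ N, 0 < P N := fun N => prod_pos fun k _ => one_sub_pow_pos h0 h1 k
  have hP1 : ∀ N, P N ≤ 1 := fun N =>
    prod_le_one (fun k _ => (one_sub_pow_pos h0 h1 k).le) fun k _ => by
      have : 0 < (r ^ 2) ^ (k + 1) := by positivity
      linarith
  have hI : Tendsto (fun N => (P N)⁻¹) atTop (𝓝 L⁻¹) := hPL.inv₀ hL.ne'
  obtain ⟨C, hC⟩ := hI.bddAbove_range
  have hC' : ∀ m, invPoch (r ^ 2) m ≤ max C 0 := fun m => by
    rw [invPoch]
    split_ifs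
    · exact (hC ⟨m.toNat, rfl⟩).trans (le_max_left _ _)
    · exact le_max_right _ _
  have tendsto_toNat : Tendsto Int.toNat atTop atTop :=
    tendsto_atTop_atTop.2 fun b => ⟨b, fun a ha => by lia⟩
  have hlim : ∀ f : ℕ → ℤ, Tendsto f atTop atTop →
      Tendsto (fun N => invPoch (r ^ 2) (f N)) atTop (𝓝 L⁻¹) := fun f hf => by
    refine (hI.comp (tendsto_toNat.comp hf)).congr' ?_
    filter_upwards [hf.eventually_ge_atTop 0] with N hN
    simp [invPoch, hN, P]
  have key : ∀ N, P N * ∏ k ∈ range N, (1 - y * r ^ (2 * k)) * (1 - y⁻¹ * r ^ (2 * k + 2)) =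
      ∑' j : ℤ, P N * (r ^ (j * (j - 1)) * (-y) ^ j * tripleCoeff (r ^ 2) N j) := fun N =>
    ((hasSum_tripleCoeff hr0 hr1 hy N).mul_left _).tsum_eq.symm
  rw [funext key]
  refine tendsto_tsum_of_dominated_convergence
    (bound := fun j => max C 0 ^ 2 * ‖r ^ (j * (j - 1)) * (-y) ^ j‖)
    ((summable_theta hr0 hr1 hy).norm.mul_left _) (fun j => ?_) (.of_forall fun N j => ?_)
  · have hN : Tendsto (fun N : ℕ => (N : ℤ)) atTop atTop := tendsto_natCast_atTop_atTop
    have h2 : Tendsto (fun N : ℕ => 2 * N) atTop atTop :=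
      tendsto_id.const_mul_atTop' two_pos
    have h := (hPL.mul ((hPL.comp h2).mul ((hlim _ (tendsto_atTop_add_const_right _ j hN)).mul
      (hlim _ (tendsto_atTop_add_const_right _ (-j) hN))))).mul_const
        (r ^ (j * (j - 1)) * (-y) ^ j)
    have e : L * (L * (L⁻¹ * L⁻¹)) = 1 := by field_simp
    rw [e, one_mul] at h
    refine h.congr fun N => ?_
    simp only [tripleCoeff, Function.comp, ← sub_eq_add_neg, P]
    ring
  · have e : P N * (r ^ (j * (j - 1)) * (-y) ^ j * tripleCoeff (r ^ 2) N j) =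
        (P N * P (2 * N)) * (invPoch (r ^ 2) (N + j) * invPoch (r ^ 2) (N - j)) *
          (r ^ (j * (j - 1)) * (-y) ^ j) := by
      simp only [tripleCoeff, P]; ring
    have hx := invPoch_nonneg h0 h1 (N + j)
    have hy := invPoch_nonneg h0 h1 (N - j)
    have hM : 0 ≤ max C 0 := le_max_right _ _
    rw [e, norm_mul]
    refine mul_le_mul_of_nonneg_right ?_ (norm_nonneg _)
    have hPP := mul_nonneg (hP0 N).le (hP0 (2 * N)).le
    rw [Real.norm_of_nonneg (mul_nonneg hPP (mul_nonneg hx hy))]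
    calc _ ≤ 1 * (max C 0 * max C 0) :=
          mul_le_mul (mul_le_one₀ (hP1 N) (hP0 _).le (hP1 _))
            (mul_le_mul (hC' _) (hC' _) hy hM) (mul_nonneg hx hy) zero_le_one
      _ = _ := by ring

end JacobiTripleProduct

section Theta

/-- The alternating Gaussian series `∑ (-1) ^ n exp (-5π (n - a) ^ 2)`. -/
noncomputable def altGauss (a : ℝ) : ℝ :=
  ∑' n : ℤ, (-1) ^ n * exp (-5 * π * (n - a) ^ 2)

lemma exp_zpow (x : ℝ) (n : ℤ) : exp x ^ n = exp (x * n) := by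
  rw [← Real.rpow_intCast, ← Real.exp_mul]

lemma altGauss_term (a : ℝ) (n : ℤ) :
    exp (-5 * π) ^ (n * (n - 1)) * (-exp (-(5 * π) * (1 - 2 * a))) ^ n =
      exp (5 * π * a ^ 2) * ((-1) ^ n * exp (-5 * π * (n - a) ^ 2)) := by
  rw [neg_eq_neg_one_mul (exp _), mul_zpow, exp_zpow, exp_zpow, mul_left_comm,
    mul_left_comm (exp _), ← Real.exp_add, ← Real.exp_add]
  congr 2
  push_cast
  ring

lemma hasSum_altGauss (a : ℝ) :
    HasSum (fun n : ℤ => (-1) ^ n * exp (-5 * π * (n - a) ^ 2)) (altGauss a) := by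
  refine Summable.hasSum ?_
  have h := summable_theta (exp_pos (-5 * π)) (Real.exp_lt_one_iff.2 (by linarith [pi_pos]))
    (exp_pos (-(5 * π) * (1 - 2 * a))).ne'
  rwa [funext (altGauss_term a), summable_mul_left_iff (exp_pos _).ne'] at h

lemma altGauss_neg (a : ℝ) : altGauss (-a) = altGauss a := by
  rw [altGauss, ← (Equiv.neg ℤ).tsum_eq, altGauss]
  refine tsum_congr fun n => ?_
  rw [Equiv.neg_apply, zpow_neg, ← inv_zpow, inv_neg_one]
  push_cast
  congr 3
  ring

/-- Poisson summation for the alternating Gaussian series. -/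
lemma hasSum_altGauss_dual (a : ℝ) :
    HasSum (fun n : ℤ => exp (-π * (2 * n - 1) ^ 2 / 20) * cos (π * a * (2 * n - 1)))
      (√5 * altGauss a) := by
  set τ : ℂ := 5 * Complex.I with hτ
  set z : ℂ := 1 / 2 - 5 * a * Complex.I with hz
  have hI := Complex.I_sq
  have hτ0 : 0 < τ.im := by simp [hτ]
  have hτ1 : 0 < (-1 / τ).im := by
    have : -1 / τ = (1 / 5 : ℝ) * Complex.I := by
      rw [hτ]; field_simp; push_cast; linear_combination -hI
    rw [this]; simp
  have h1 : (altGauss a : ℂ) = Complex.exp (-5 * π * a ^ 2) * jacobiTheta₂ z τ := by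
    have h := (hasSum_jacobiTheta₂_term z hτ0).mul_left (Complex.exp (-5 * π * a ^ 2))
    refine (Complex.hasSum_ofReal.2 (hasSum_altGauss a)).unique ?_
    refine (congrArg (HasSum · _) (funext fun n => ?_)).mp h
    have : ((-1 : ℝ) ^ n : ℝ) = (Complex.exp (π * Complex.I * n)) := by
      rw [mul_comm, Complex.exp_int_mul, Complex.exp_pi_mul_I]; push_cast; rfl
    push_cast at this ⊢
    rw [this, jacobiTheta₂_term, ← Complex.exp_add, ← Complex.exp_add]
    congr 1
    rw [hz, hτ]
    linear_combination (-10 * π * a * n + 5 * π * n ^ 2 : ℂ) * hI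
  have h2 : (-Complex.I * τ) ^ (1 / 2 : ℂ) = (√5 : ℝ) := by
    rw [show -Complex.I * τ = ((5 : ℝ) : ℂ) by rw [hτ]; push_cast; linear_combination -5 * hI,
      Real.sqrt_eq_rpow, Complex.ofReal_cpow (by norm_num)]
    push_cast; rfl
  have h5 : ((√5 : ℝ) : ℂ) ≠ 0 := by
    rw [Complex.ofReal_ne_zero]; positivity
  have h := (hasSum_jacobiTheta₂_term (z / τ) hτ1).mul_left
    (Complex.exp (-5 * π * a ^ 2) * Complex.exp (-π * Complex.I * z ^ 2 / τ))
  have h3 : Complex.exp (-5 * π * a ^ 2) * Complex.exp (-π * Complex.I * z ^ 2 / τ) *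
      jacobiTheta₂ (z / τ) (-1 / τ) = ((√5 * altGauss a : ℝ) : ℂ) := by
    rw [Complex.ofReal_mul, h1, jacobiTheta₂_functional_equation z τ, h2]
    field_simp
  rw [h3] at h
  have h := Complex.hasSum_re h
  rw [Complex.ofReal_re] at h
  refine (congrArg (HasSum · _) (funext fun n => ?_)).mp h
  have e1 : z / τ = -a - Complex.I / 10 := by
    rw [hz, hτ]; field_simp; linear_combination 10 * hI
  have e2 : -1 / τ = Complex.I / 5 := by
    rw [hτ]; field_simp; linear_combination -hI
  have e3 : -π * Complex.I * z ^ 2 / τ = -π / 5 * z ^ 2 := by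
    rw [hτ]; field_simp
  have e4 : (-5 * π * a ^ 2 + -π / 5 * z ^ 2 + (2 * π * Complex.I * n * (z / τ) +
      π * Complex.I * n ^ 2 * (-1 / τ)) : ℂ) =
      ((-π * (2 * n - 1) ^ 2 / 20 : ℝ) : ℂ) + ((-(π * a * (2 * n - 1)) : ℝ) : ℂ) * Complex.I := by
    rw [e1, e2, hz]
    push_cast
    linear_combination (π * n ^ 2 / 5 - π * n / 5 - 5 * π * a ^ 2 : ℂ) * hI
  rw [jacobiTheta₂_term, e3, ← Complex.exp_add, ← Complex.exp_add, e4, Complex.exp_re]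
  simp only [Complex.add_re, Complex.add_im, Complex.ofReal_re, Complex.ofReal_im,
    Complex.re_ofReal_mul, Complex.im_ofReal_mul, Complex.I_re, Complex.I_im, mul_zero, mul_one,
    add_zero, zero_add, Real.cos_neg]

lemma hasSum_int_div_five {f : ℤ → ℝ} {s : ℝ} (hf : HasSum f s) :
    HasSum (fun k : ℤ =>
      f (5 * k) + f (5 * k + 1) + f (5 * k + 2) + f (5 * k + 3) + f (5 * k + 4)) s := by
  have h := ((Int.divModEquiv 5).symm.hasSum_iff.2 hf).prod_fiberwise
    fun k => hasSum_fintype _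
  refine (congrArg (HasSum · _) (funext fun k => ?_)).mp h
  simp [Fin.sum_univ_five, mul_comm]

lemma altGauss_three_tenths :
    √5 * altGauss (3 / 10) =
      2 * cos (3 * π / 10) * altGauss (1 / 10) - 2 * cos (π / 10) * altGauss (3 / 10) := by
  have hd := hasSum_int_div_five
    ((Equiv.addRight (-1 : ℤ)).hasSum_iff.2 (hasSum_altGauss_dual (3 / 10)))
  have hs := ((((hasSum_altGauss (3 / 10)).mul_left (-cos (π / 10))).add
    ((hasSum_altGauss (1 / 10)).mul_left (cos (3 * π / 10)))).add
    ((hasSum_altGauss (-(1 / 10))).mul_left (cos (3 * π / 10)))).add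
    ((hasSum_altGauss (-(3 / 10))).mul_left (-cos (π / 10)))
  rw [altGauss_neg, altGauss_neg] at hs
  have key : ∀ (k c : ℝ) (m : ℤ), k = m →
      exp (-π * (10 * k + c) ^ 2 / 20) * cos (π * (3 / 10) * (10 * k + c)) =
        cos (3 * c * π / 10) * ((-1) ^ m * exp (-5 * π * (k - -(c / 10)) ^ 2)) := by
    rintro _ c m rfl
    have e : π * (3 / 10) * (10 * m + c) = 3 * c * π / 10 + (3 * m : ℤ) * π := by
      push_cast; ring
    have e' : ((-1 : ℝ)) ^ (3 * m) = (-1) ^ m := by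
      rw [zpow_mul]; norm_num
    rw [e, Real.cos_add_int_mul_pi, e']
    ring_nf
  have c3 : cos (9 * π / 10) = -cos (π / 10) := by
    rw [← Real.cos_pi_sub]; congr 1; ring
  have c5 : cos (3 * 5 * π / 10) = 0 := by
    rw [← Real.cos_pi_div_two, ← Real.cos_sub_two_pi, ← Real.cos_neg]; congr 1; ring
  rw [hd.unique ((congrArg (HasSum · _) (funext fun k => ?_)).mp hs)]
  · ring
  have k0 := key k (-3) k rfl
  have k1 := key k (-1) k rfl
  have k2 := key k 1 k rfl
  have k3 := key k 3 k rfl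
  have k5 := key k 5 k rfl
  rw [c5, zero_mul] at k5
  rw [show 3 * -3 * π / 10 = -(9 * π / 10) by ring, Real.cos_neg, c3] at k0
  rw [show 3 * -1 * π / 10 = -(3 * π / 10) by ring, Real.cos_neg] at k1
  rw [show 3 * 1 * π / 10 = 3 * π / 10 by ring] at k2
  rw [show 3 * 3 * π / 10 = 9 * π / 10 by ring, c3] at k3
  simp only [Function.comp, Equiv.coe_addRight]
  push_cast
  ring_nf at k0 k1 k2 k3 k5 ⊢
  linarith

lemma cos_pi_div_ten_sq : cos (π / 10) ^ 2 = (5 + √5) / 8 := by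
  rw [Real.cos_sq, show 2 * (π / 10) = π / 5 by ring, Real.cos_pi_div_five]
  ring

lemma altGauss_ratio (h : altGauss (1 / 10) ≠ 0) :
    altGauss (3 / 10) / altGauss (1 / 10) = -1 / 2 - √5 / 2 + √((5 + √5) / 2) := by
  have hc : 0 < cos (π / 10) := Real.cos_pos_of_mem_Ioo ⟨by linarith [pi_pos], by linarith [pi_pos]⟩
  have hw : √((5 + √5) / 2) = 2 * cos (π / 10) := by
    rw [Real.sqrt_eq_iff_mul_self_eq (by positivity) (by positivity)]
    linear_combination -4 * cos_pi_div_ten_sq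
  have h5 : √5 ^ 2 = 5 := Real.sq_sqrt (by norm_num)
  have h3 : cos (3 * π / 10) = cos (π / 10) * (√5 - 1) / 2 := by
    rw [show 3 * π / 10 = 3 * (π / 10) by ring, Real.cos_three_mul]
    linear_combination 4 * cos (π / 10) * cos_pi_div_ten_sq
  have hpos : √5 + 2 * cos (π / 10) ≠ 0 := by positivity
  have hm := altGauss_three_tenths
  rw [h3] at hm
  rw [hw, div_eq_iff h]
  apply mul_left_cancel₀ hpos
  linear_combination hm - altGauss (1 / 10) * (4 * cos_pi_div_ten_sq - h5 / 2)

end Theta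

section Product

variable {q : ℝ}

lemma multipliable_RR (h0 : 0 < q) (h1 : q < 1) :
    Multipliable fun n : ℕ => (1 - q ^ (n + 1)) ^ chi5 (n + 1) := by
  have hs : Summable fun n : ℕ => ‖(1 - q ^ (n + 1)) ^ chi5 (n + 1) - 1‖ := by
    refine Summable.of_nonneg_of_le (fun _ => norm_nonneg _) (fun n => ?_)
      ((((summable_nat_add_iff 1).2 (summable_geometric_of_lt_one h0.le h1))).mul_left (1 - q)⁻¹)
    have hx : 0 < q ^ (n + 1) := by positivity
    have hxq : q ^ (n + 1) ≤ q := pow_le_of_le_one h0.le h1.le n.succ_ne_zero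
    have hq : 0 < 1 - q := sub_pos.2 h1
    have hi : 1 ≤ (1 - q)⁻¹ := (one_le_inv₀ hq).2 (by linarith)
    set x := q ^ (n + 1)
    have hx1 : 0 < 1 - x := by linarith
    rw [chi5]
    split_ifs
    · rw [zpow_one, show 1 - x - 1 = -x by ring, norm_neg, Real.norm_of_nonneg hx.le]
      nlinarith
    · have e : (1 - x) ^ (-1 : ℤ) - 1 = (1 - x)⁻¹ * x := by
        rw [zpow_neg_one]; field_simp; ring
      rw [e, Real.norm_of_nonneg (by positivity)]
      gcongr
    · rw [zpow_zero, sub_self, norm_zero]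
      positivity
  simpa using multipliable_one_add_of_summable hs

lemma prod_RR (q : ℝ) (N : ℕ) :
    ∏ n ∈ range (5 * N), (1 - q ^ (n + 1)) ^ chi5 (n + 1) =
      (∏ k ∈ range N, (1 - q ^ (5 * k + 1)) * (1 - q ^ (5 * k + 4))) /
        ∏ k ∈ range N, (1 - q ^ (5 * k + 2)) * (1 - q ^ (5 * k + 3)) := by
  induction N with
  | zero => simp
  | succ N ih =>
    have c1 : chi5 (5 * N + 1) = 1 := by simp only [chi5]; grind
    have c2 : chi5 (5 * N + 1 + 1) = -1 := by simp only [chi5]; grind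
    have c3 : chi5 (5 * N + 2 + 1) = -1 := by simp only [chi5]; grind
    have c4 : chi5 (5 * N + 3 + 1) = 1 := by simp only [chi5]; grind
    have c5 : chi5 (5 * N + 4 + 1) = 0 := by simp only [chi5]; grind
    rw [show 5 * (N + 1) = 5 * N + 4 + 1 by ring, prod_range_succ, prod_range_succ,
      prod_range_succ, prod_range_succ, prod_range_succ, ih, prod_range_succ, prod_range_succ,
      c1, c2, c3, c4, c5]
    simp only [zpow_one, zpow_neg, zpow_zero, div_eq_mul_inv, mul_inv]
    ring

end Product

lemma tendsto_prod_altGauss (a : ℝ) :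
    Tendsto (fun N => (∏ k ∈ range N, (1 - exp (-(2 * π)) ^ (5 * (k + 1)))) *
      ∏ k ∈ range N, (1 - exp (-(5 * π) * (1 - 2 * a)) * exp (-(2 * π)) ^ (5 * k)) *
        (1 - exp (-(5 * π) * (1 + 2 * a)) * exp (-(2 * π)) ^ (5 * k))) atTop
      (𝓝 (exp (5 * π * a ^ 2) * altGauss a)) := by
  have h := tendsto_jacobi_triple_product (exp_pos (-5 * π))
    (Real.exp_lt_one_iff.2 (by linarith [pi_pos])) (exp_pos (-(5 * π) * (1 - 2 * a))).ne'
  rw [tsum_congr (altGauss_term a), tsum_mul_left] at h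
  refine h.congr fun N => ?_
  have e : ∀ k, exp (-5 * π) ^ (2 * k) = exp (-(2 * π)) ^ (5 * k) := fun k => by
    rw [← Real.exp_nat_mul, ← Real.exp_nat_mul]; congr 1; push_cast; ring
  have e' : ∀ k, (exp (-(5 * π) * (1 - 2 * a)))⁻¹ * exp (-5 * π) ^ (2 * k + 2) =
      exp (-(5 * π) * (1 + 2 * a)) * exp (-(2 * π)) ^ (5 * k) := fun k => by
    rw [← Real.exp_nat_mul, ← Real.exp_nat_mul, ← Real.exp_neg, ← Real.exp_add, ← Real.exp_add]
    congr 1; push_cast; ring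
  simp only [← pow_mul, e, e']

theorem RR_exp_neg_two_pi :
    RR (Real.exp (-(2 * π))) =
      -1 / 2 - Real.sqrt 5 / 2 + Real.sqrt ((5 + Real.sqrt 5) / 2) := by
  set q := exp (-(2 * π)) with hq
  have h0 : 0 < q := exp_pos _
  have h1 : q < 1 := Real.exp_lt_one_iff.2 (by linarith [pi_pos])
  have hsum : ∀ m, Summable fun k => q ^ (5 * k + (m + 1)) := fun m => by
    simp only [pow_add, pow_mul]
    exact (summable_geometric_of_lt_one (by positivity)
      (pow_lt_one₀ h0.le h1 (by norm_num))).mul_right _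
  have hpos : ∀ m k, 0 ≤ q ^ (5 * k + (m + 1)) := fun m k => by positivity
  have hlt : ∀ m k, q ^ (5 * k + (m + 1)) < 1 := fun m k => pow_lt_one₀ h0.le h1 (by lia)
  obtain ⟨L₂, hL₂, ht₂⟩ := exists_tendsto_prod_one_sub (hsum 1) (hpos 1) (hlt 1)
  obtain ⟨L₃, hL₃, ht₃⟩ := exists_tendsto_prod_one_sub (hsum 2) (hpos 2) (hlt 2)
  obtain ⟨L₅, hL₅, ht₅⟩ := exists_tendsto_prod_one_sub (hsum 4) (hpos 4) (hlt 4)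
  have hA := tendsto_prod_altGauss (3 / 10)
  have hB := tendsto_prod_altGauss (1 / 10)
  have e : ∀ (x : ℝ) (m k : ℕ), x = -(2 * π) * m → exp x * q ^ (5 * k) = q ^ (5 * k + m) := by
    rintro _ m k rfl
    rw [mul_comm, pow_add, hq, ← Real.exp_nat_mul _ m, mul_comm (m : ℝ)]
  rw [← hq] at hA hB
  simp only [e (-(5 * π) * (1 - 2 * (3 / 10))) 1 _ (by push_cast; ring),
    e (-(5 * π) * (1 + 2 * (3 / 10))) 4 _ (by push_cast; ring), mul_add_one] at hA
  simp only [e (-(5 * π) * (1 - 2 * (1 / 10))) 2 _ (by push_cast; ring),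
    e (-(5 * π) * (1 + 2 * (1 / 10))) 3 _ (by push_cast; ring), mul_add_one] at hB
  have hB0 : exp (5 * π * (1 / 10) ^ 2) * altGauss (1 / 10) ≠ 0 := by
    have := ht₅.mul (ht₂.mul ht₃)
    simp only [← prod_mul_distrib] at this hB
    rw [tendsto_nhds_unique hB this]
    positivity
  have hS : altGauss (1 / 10) ≠ 0 := right_ne_zero_of_mul hB0
  have hR := (multipliable_RR h0 h1).tendsto_prod_tprod_nat.comp
    (tendsto_id.const_mul_atTop' (show 0 < 5 by norm_num))
  have hlim := tendsto_nhds_unique hR ((hA.div hB hB0).congr fun N => by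
    have : ∏ k ∈ range N, (1 - q ^ (5 * k + 5)) ≠ 0 :=
      prod_ne_zero_iff.2 fun k _ => (sub_pos.2 (hlt 4 k)).ne'
    simp only [Function.comp, id, Pi.div_apply]
    rw [prod_RR, mul_div_mul_left _ _ this])
  rw [← altGauss_ratio hS, RR, hlim, hq, ← Real.exp_mul, mul_div_mul_comm, ← Real.exp_sub,
    ← mul_assoc, ← Real.exp_add]
  rw [show -(2 * π) * (1 / 5) + (5 * π * (3 / 10) ^ 2 - 5 * π * (1 / 10) ^ 2) = 0 by ring,
    Real.exp_zero, one_mul]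
end
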